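/- arXiv:math/0306360 — 3 statements merged into one kernel-verified Lean document; each statement's English description precedes it below -/
import Mathlib

section
/- For every integer d ≥ 8 there exists a nonzero homogeneous polynomial F ∈ ℂ[z₁,z₂,z₃,z₄] of degree d such that every holomorphic map g : ℂ → ℂ⁴ with g(w) ≠ 0 for all w ∈ ℂ and F(g(w)) = 0 for all w ∈ ℂ has pairwise linearly dependent values, i.e. g(w) and g(w′) are linearly dependent over ℂ for all w, w′ ∈ ℂ. (Equivalently: there exists a Brody hyperbolic surface of degree d in ℙ³.) -/
open MvPolynomial

open Filter Topology Metric

/-- The point-picking lemma behind the Brody and Zalcman rescalings. -/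
lemma exists_rescaling_center {D : ℂ → ℝ} (hD : Continuous D) {w₀ : ℂ}
    (h₀ : 0 < D w₀) {R : ℝ} (hR : 0 < R) :
    ∃ a, 0 < D a ∧ ∀ w, ‖w - a‖ * D a ≤ R → D w ≤ 2 * D a := by
  set r : ℝ := 2 * R / D w₀ with hr
  have hr0 : 0 < r := by positivity
  obtain ⟨a, ha, hmax⟩ := (isCompact_closedBall w₀ r).exists_isMaxOn
    ⟨w₀, mem_closedBall_self hr0.le⟩
    (f := fun w => (r - ‖w - w₀‖) * D w) (by fun_prop)
  have h1 : 2 * R ≤ (r - ‖a - w₀‖) * D a := by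
    have := hmax (mem_closedBall_self hr0.le)
    simp only [Set.mem_ofPred_eq, sub_self, norm_zero, sub_zero] at this
    have e : r * D w₀ = 2 * R := by rw [hr]; field_simp
    linarith
  have ha' : ‖a - w₀‖ ≤ r := by simpa [dist_eq_norm] using ha
  have hDa : 0 < D a := by
    by_contra! hc
    nlinarith [mul_nonneg (sub_nonneg.2 ha') (neg_nonneg.2 hc)]
  refine ⟨a, hDa, fun w hw => ?_⟩
  have h2 : 2 * ‖w - a‖ ≤ r - ‖a - w₀‖ := by
    by_contra! hc
    nlinarith
  have h3 : ‖w - w₀‖ ≤ ‖w - a‖ + ‖a - w₀‖ := by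
    simpa using norm_add_le (w - a) (a - w₀)
  have h4 : 0 < r - ‖a - w₀‖ := by
    by_contra! hc
    nlinarith
  have h5 : (r - ‖w - w₀‖) * D w ≤ (r - ‖a - w₀‖) * D a :=
    hmax (show w ∈ closedBall w₀ r by rw [mem_closedBall, dist_eq_norm]; linarith)
  by_contra! hc
  nlinarith

/-- An entire function whose derivative dominates the square of its norm vanishes. -/
lemma eq_zero_of_sq_norm_le_norm_deriv {E : Type*} [NormedAddCommGroup E] [NormedSpace ℂ E]
    {H : ℂ → E} (hH : Differentiable ℂ H) {c : ℝ} (hc : 0 < c)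
    (h : ∀ w, c * ‖H w‖ ^ 2 ≤ ‖deriv H w‖) (w : ℂ) : H w = 0 := by
  by_contra hw
  obtain ⟨a, ha, hb⟩ := exists_rescaling_center (D := fun w => ‖H w‖) hH.continuous.norm
    (norm_pos_iff.2 hw) (R := 4 / c) (by positivity)
  have hR : 0 < 4 / c / ‖H a‖ := by positivity
  have := Complex.norm_deriv_le_of_forall_mem_sphere_norm_le (c := a) hR
    (C := 2 * ‖H a‖) hH.diffContOnCl (fun z hz => hb z (by
      rw [mem_sphere, dist_eq_norm] at hz
      rw [hz]; apply le_of_eq; field_simp))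
  have h1 := h a
  have e : 2 * ‖H a‖ / (4 / c / ‖H a‖) = c * ‖H a‖ ^ 2 / 2 := by field_simp; ring
  rw [e] at this
  have : 0 < c * ‖H a‖ ^ 2 := by positivity
  linarith

lemma exists_norm_apply_eq {ι : Type*} [Fintype ι] [Nonempty ι] (x : ι → ℂ) :
    ∃ i, ‖x i‖ = ‖x‖ := by
  obtain ⟨i, hi⟩ := Finite.exists_max fun i => ‖x i‖
  exact ⟨i, le_antisymm (norm_le_pi_norm x i) ((pi_norm_le_iff_of_nonneg (norm_nonneg _)).2 hi)⟩

section Proportional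

variable {ι : Type*}

/-- Two vectors are proportional when all `2 × 2` minors vanish. -/
def Proportional (x y : ι → ℂ) : Prop := ∀ a b, x a * y b = x b * y a

lemma Proportional.symm {x y : ι → ℂ} (h : Proportional x y) : Proportional y x := fun a b => by
  linear_combination -h a b

lemma Proportional.exists_smul {x y : ι → ℂ} (h : Proportional x y) (hx : x ≠ 0) (hy : y ≠ 0) :
    ∃ c : ℂ, c ≠ 0 ∧ x = c • y := by
  obtain ⟨b, hb⟩ := Function.ne_iff.1 hy
  have e : x = (x b / y b) • y := by
    ext a
    have := h a b
    simp only [Pi.zero_apply] at hb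
    simp only [Pi.smul_apply, smul_eq_mul]
    field_simp
    exact this
  refine ⟨x b / y b, fun h0 => hx ?_, e⟩
  rw [e, h0, zero_smul]

lemma Proportional.trans {x y z : ι → ℂ} (h : Proportional x y) (h' : Proportional y z)
    (hy : y ≠ 0) : Proportional x z := by
  obtain ⟨c, hc⟩ := Function.ne_iff.1 hy
  intro a b
  apply mul_right_cancel₀ hc
  linear_combination (-x a) * h' b c + z c * h a b + x b * h' a c

lemma proportional_smul_left {x : ι → ℂ} (c : ℂ) : Proportional (c • x) x := fun a b => by
  simp only [Pi.smul_apply, smul_eq_mul]; ring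

variable [Fintype ι]

/-- `h` is a holomorphic lift of `f` near `w₀`, when `f` is seen as a map to projective space. -/
structure IsLiftAt (f h : ℂ → ι → ℂ) (w₀ : ℂ) : Prop where
  analyticAt : AnalyticAt ℂ h w₀
  ne_zero : h w₀ ≠ 0
  eventually : ∀ᶠ w in 𝓝 w₀, f w ≠ 0 ∧ Proportional (f w) (h w)

/-- A map to a vector space, avoiding the origin, whose composition with the projection to
projective space is holomorphic. -/
def IsProjHol (f : ℂ → ι → ℂ) : Prop := ∀ w₀, ∃ h, IsLiftAt f h w₀

/-- The `2 × 2` minors formed by a curve and its derivative. -/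
noncomputable def minors (g : ℂ → ι → ℂ) (w : ℂ) (a b : ι) : ℂ :=
  g w a * deriv g w b - g w b * deriv g w a

namespace IsLiftAt

variable {f h k : ℂ → ι → ℂ} {w₀ : ℂ}

lemma eventually_ne_zero (hh : IsLiftAt f h w₀) : ∀ᶠ w in 𝓝 w₀, h w ≠ 0 :=
  hh.analyticAt.continuousAt.eventually_ne hh.ne_zero

lemma eventually_isLiftAt (hh : IsLiftAt f h w₀) : ∀ᶠ w in 𝓝 w₀, IsLiftAt f h w := by
  filter_upwards [hh.analyticAt.eventually_analyticAt, hh.eventually_ne_zero,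
    hh.eventually.eventually_nhds] with w h1 h2 h3
  exact ⟨h1, h2, h3⟩

lemma exists_smul (hh : IsLiftAt f h w₀) : ∃ c : ℂ, c ≠ 0 ∧ f w₀ = c • h w₀ :=
  hh.eventually.self_of_nhds.2.exists_smul hh.eventually.self_of_nhds.1 hh.ne_zero

lemma apply_analyticAt (hh : IsLiftAt f h w₀) (a : ι) : AnalyticAt ℂ (fun w => h w a) w₀ :=
  (analyticAt_pi_iff.1 hh.analyticAt) a

lemma eventually_eq_smul (hh : IsLiftAt f h w₀) (hk : IsLiftAt f k w₀) :
    ∃ c : ℂ → ℂ, AnalyticAt ℂ c w₀ ∧ c w₀ ≠ 0 ∧ ∀ᶠ w in 𝓝 w₀, h w = c w • k w := by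
  obtain ⟨b, hb⟩ := Function.ne_iff.1 hk.ne_zero
  have e : ∀ᶠ w in 𝓝 w₀, h w = (h w b / k w b) • k w := by
    filter_upwards [(hk.apply_analyticAt b).continuousAt.eventually_ne hb, hh.eventually,
      hk.eventually] with w hb h1 h2
    have := (h1.2.symm.trans h2.2 h1.1)
    ext a
    have := this a b
    simp only [Pi.zero_apply] at hb
    simp only [Pi.smul_apply, smul_eq_mul]
    field_simp
    exact this
  refine ⟨fun w => h w b / k w b, (hh.apply_analyticAt b).div (hk.apply_analyticAt b) hb, ?_, e⟩
  intro h0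
  replace h0 : h w₀ b / k w₀ b = 0 := h0
  apply hh.ne_zero
  rw [e.self_of_nhds, h0, zero_smul]

lemma eventually_zero_iff (hh : IsLiftAt f h w₀) {φ : (ι → ℂ) → ℂ}
    (hφ : ∀ c : ℂ, c ≠ 0 → ∀ x, φ (c • x) = 0 ↔ φ x = 0) :
    ∀ᶠ w in 𝓝 w₀, (φ (f w) = 0 ↔ φ (h w) = 0) := by
  filter_upwards [hh.eventually_isLiftAt] with w hw
  obtain ⟨c, hc, e⟩ := hw.exists_smul
  rw [e, hφ c hc]

end IsLiftAt

lemma minors_eq_of_eventually_eq_smul {h k : ℂ → ι → ℂ} {w : ℂ} {c : ℂ → ℂ}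
    (hc : DifferentiableAt ℂ c w) (hk : DifferentiableAt ℂ k w) (e : ∀ᶠ z in 𝓝 w, h z = c z • k z) :
    minors h w = (c w ^ 2) • minors k w := by
  have hd : deriv h w = c w • deriv k w + deriv c w • k w := by
    have : h =ᶠ[𝓝 w] fun z => c z • k z := e
    rw [this.deriv_eq]
    exact deriv_fun_smul hc hk
  ext a b
  simp only [minors, hd, e.self_of_nhds, Pi.smul_apply, Pi.add_apply, smul_eq_mul]
  ring

/-- If the minors of a curve and its derivative vanish, the curve has constant direction. -/
lemma eventually_proportional_of_minors_eq_zero {h : ℂ → ι → ℂ} {w₀ : ℂ}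
    (ha : AnalyticAt ℂ h w₀) (h0 : h w₀ ≠ 0) (hW : ∀ᶠ w in 𝓝 w₀, minors h w = 0) :
    ∀ᶠ w in 𝓝 w₀, Proportional (h w) (h w₀) := by
  obtain ⟨b, hb⟩ := Function.ne_iff.1 h0
  have hc : ∀ a, AnalyticAt ℂ (fun w => h w a) w₀ := fun a => (analyticAt_pi_iff.1 ha) a
  obtain ⟨r, hr, H⟩ := Metric.eventually_nhds_iff_ball.1
    (hW.and (((hc b).continuousAt.eventually_ne hb).and ha.eventually_analyticAt))
  have key : ∀ a, ∀ w ∈ ball w₀ r, h w a / h w b = h w₀ a / h w₀ b := by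
    intro a w hw
    have hd : ∀ z ∈ ball w₀ r, HasDerivAt (fun z => h z a / h z b) 0 z := by
      intro z hz
      obtain ⟨h1, h2, h3⟩ := H z hz
      have := (hasDerivAt_pi.1 h3.differentiableAt.hasDerivAt)
      have h4 := congrFun (congrFun h1 a) b
      simp only [minors, Pi.zero_apply] at h4
      refine ((this a).div (this b) h2).congr_deriv ?_
      rw [div_eq_zero_iff]
      left; linear_combination -h4
    exact (convex_ball w₀ r).is_const_of_fderivWithin_eq_zero (𝕜 := ℂ)
      (f := fun z => h z a / h z b)
      (fun z hz => (hd z hz).differentiableAt.differentiableWithinAt)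
      (fun z hz => by
        rw [fderivWithin_of_isOpen isOpen_ball hz]
        ext; simpa using (hd z hz).deriv) hw (mem_ball_self hr)
  filter_upwards [ball_mem_nhds w₀ hr] with w hw
  intro a c
  have e1 := key a w hw
  have e2 := key c w hw
  have e3 := (H w hw).2.1
  simp only [Pi.zero_apply] at hb e3
  have e4 : h w a = h w b * (h w₀ a / h w₀ b) := by rw [← e1]; field_simp
  have e5 : h w c = h w b * (h w₀ c / h w₀ b) := by rw [← e2]; field_simp
  rw [e4, e5]; field_simp

namespace IsProjHol

variable {f : ℂ → ι → ℂ}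

lemma ne_zero (hf : IsProjHol f) (w : ℂ) : f w ≠ 0 := by
  obtain ⟨h, hh⟩ := hf w
  exact hh.eventually.self_of_nhds.1

lemma of_differentiable (hf : Differentiable ℂ f) (h0 : ∀ w, f w ≠ 0) : IsProjHol f := fun w =>
  ⟨f, hf.analyticAt w, h0 w, Eventually.of_forall fun z => ⟨h0 z, fun a b => by ring⟩⟩

/-- The identity principle for conical conditions along a projectively holomorphic curve. -/
lemma forall_eq_zero (hf : IsProjHol f) {φ : (ι → ℂ) → ℂ} (hφa : Differentiable ℂ φ)
    (hφ : ∀ c : ℂ, c ≠ 0 → ∀ x, φ (c • x) = 0 ↔ φ x = 0) {w₀ : ℂ}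
    (h0 : ∀ᶠ w in 𝓝 w₀, φ (f w) = 0) (w : ℂ) : φ (f w) = 0 := by
  set S : Set ℂ := {w | ∀ᶠ z in 𝓝 w, φ (f z) = 0} with hS
  have hSo : IsOpen S := isOpen_setOfPred_eventually_nhds
  have hSc : IsClosed S := by
    refine isClosed_of_closure_subset fun z hz => ?_
    obtain ⟨h, hh⟩ := hf z
    have han : AnalyticAt ℂ (fun w => φ (h w)) z := by
      refine DifferentiableOn.analyticAt (s := {w | AnalyticAt ℂ h w}) ?_
        hh.analyticAt.eventually_analyticAt
      intro w hw
      exact ((hφa _).comp w (AnalyticAt.differentiableAt hw)).differentiableWithinAt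
    rcases han.eventually_eq_zero_or_eventually_ne_zero with h1 | h1
    · filter_upwards [h1, hh.eventually_zero_iff hφ] with w hw hw' using hw'.2 hw
    · exfalso
      rw [eventually_nhdsWithin_iff] at h1
      have h2 := (h1.and (hh.eventually_zero_iff hφ)).eventually_nhds
      obtain ⟨y, hy, hyS⟩ := ((mem_closure_iff_frequently.1 hz).and_eventually h2).exists
      have h3 : ∀ᶠ x in 𝓝 y, x = z := by
        filter_upwards [hy, hyS] with x hx hx'
        by_contra hne
        exact hx'.1 hne (hx'.2.1 hx)
      have h4 : y = z := h3.self_of_nhds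
      subst h4
      have h5 : ∀ᶠ x in 𝓝[≠] y, x = y := h3.filter_mono nhdsWithin_le_nhds
      obtain ⟨x, hx, hx'⟩ := (h5.and self_mem_nhdsWithin).exists
      exact hx' hx
  have : S = Set.univ := IsClopen.eq_univ ⟨hSc, hSo⟩ ⟨w₀, h0⟩
  have hw : w ∈ S := this ▸ Set.mem_univ w
  exact hw.self_of_nhds

lemma forall_eq_zero_or (hf : IsProjHol f) {φ ψ : (ι → ℂ) → ℂ} (hφa : Differentiable ℂ φ)
    (hψa : Differentiable ℂ ψ)
    (hφ : ∀ c : ℂ, c ≠ 0 → ∀ x, φ (c • x) = 0 ↔ φ x = 0)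
    (hψ : ∀ c : ℂ, c ≠ 0 → ∀ x, ψ (c • x) = 0 ↔ ψ x = 0)
    (h : ∀ w, φ (f w) = 0 ∨ ψ (f w) = 0) : (∀ w, φ (f w) = 0) ∨ ∀ w, ψ (f w) = 0 := by
  by_contra! hc
  obtain ⟨⟨w₀, hw₀⟩, w₁, hw₁⟩ := hc
  refine hw₁ (hf.forall_eq_zero hψa hψ (w₀ := w₀) ?_ w₁)
  obtain ⟨k, hk⟩ := hf w₀
  have hk0 : φ (k w₀) ≠ 0 := fun h => hw₀ ((hk.eventually_zero_iff hφ).self_of_nhds.2 h)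
  have := (hφa.continuous.continuousAt.comp hk.analyticAt.continuousAt).eventually_ne hk0
  filter_upwards [this, hk.eventually_zero_iff hφ] with w h1 h2
  exact (h w).resolve_left fun h3 => h1 (h2.1 h3)

lemma proportional_of_eventually (hf : IsProjHol f) {w₀ : ℂ} {c : ι → ℂ}
    (h : ∀ᶠ w in 𝓝 w₀, Proportional (f w) c) (w : ℂ) : Proportional (f w) c := by
  intro a b
  rw [← sub_eq_zero]
  refine hf.forall_eq_zero (φ := fun x => x a * c b - x b * c a) (by fun_prop) ?_ (w₀ := w₀) ?_ w
  · intro t ht x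
    have : (t • x) a * c b - (t • x) b * c a = t * (x a * c b - x b * c a) := by
      simp only [Pi.smul_apply, smul_eq_mul]; ring
    show (t • x) a * c b - (t • x) b * c a = 0 ↔ _
    rw [this]
    simp [ht]
  · filter_upwards [h] with w hw
    rw [sub_eq_zero]; exact hw a b

lemma proportional_of_minors_eq_zero (hf : IsProjHol f) {w₀ : ℂ} {h : ℂ → ι → ℂ}
    (hh : IsLiftAt f h w₀) (hW : ∀ᶠ w in 𝓝 w₀, minors h w = 0) (w w' : ℂ) :
    Proportional (f w) (f w') := by
  have h1 : ∀ w, Proportional (f w) (h w₀) := by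
    refine hf.proportional_of_eventually (w₀ := w₀) ?_
    filter_upwards [eventually_proportional_of_minors_eq_zero hh.analyticAt hh.ne_zero hW,
      hh.eventually, hh.eventually_ne_zero] with w h1 h2 h3
    exact h2.2.trans h1 h3
  exact (h1 w).trans (h1 w').symm hh.ne_zero

end IsProjHol

end Proportional

/-- A plane curve `P = 0` of degree `m + 4` with gradient `Q`, smooth away from the origin. -/
structure IsSmoothPlaneCurve (m : ℕ) (P : (Fin 3 → ℂ) → ℂ) (Q : Fin 3 → (Fin 3 → ℂ) → ℂ) :
    Prop where
  hasDerivAt_comp : ∀ (g : ℂ → Fin 3 → ℂ) (g' : Fin 3 → ℂ) (w : ℂ), HasDerivAt g g' w →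
    HasDerivAt (fun z => P (g z)) (∑ l, Q l (g w) * g' l) w
  map_smul : ∀ c x, P (c • x) = c ^ (m + 4) * P x
  euler : ∀ x, P x = 0 → ∑ l, Q l x * x l = 0
  grad_differentiable : ∀ l, Differentiable ℂ (Q l)
  grad_smul : ∀ l c x, Q l (c • x) = c ^ (m + 3) * Q l x
  grad_ne_zero : ∀ x, x ≠ 0 → ∃ l, Q l x ≠ 0

namespace IsSmoothPlaneCurve

variable {m : ℕ} {P : (Fin 3 → ℂ) → ℂ} {Q : Fin 3 → (Fin 3 → ℂ) → ℂ}

lemma map_smul_eq_zero_iff (hP : IsSmoothPlaneCurve m P Q) (c : ℂ) (hc : c ≠ 0) (x : Fin 3 → ℂ) :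
    P (c • x) = 0 ↔ P x = 0 := by
  rw [hP.map_smul]; simp [hc]

lemma exists_grad_lower_bound (hP : IsSmoothPlaneCurve m P Q) :
    ∃ c : ℝ, 0 < c ∧ ∀ x, ∃ l, c * ‖x‖ ^ (m + 3) ≤ ‖Q l x‖ := by
  have hc : Continuous fun x : Fin 3 → ℂ => ‖fun l => Q l x‖ :=
    (continuous_pi fun l => (hP.grad_differentiable l).continuous).norm
  obtain ⟨y, hy, hmin⟩ := (isCompact_sphere (0 : Fin 3 → ℂ) 1).exists_isMinOn
    (NormedSpace.sphere_nonempty.2 zero_le_one) hc.continuousOn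
  have hy1 : ‖y‖ = 1 := by simpa using hy
  have hy0 : y ≠ 0 := fun h => by simp [h] at hy1
  refine ⟨‖fun l => Q l y‖, ?_, fun x => ?_⟩
  · rw [norm_pos_iff]
    obtain ⟨l, hl⟩ := hP.grad_ne_zero y hy0
    exact fun h => hl (congrFun h l)
  · by_cases hx : x = 0
    · exact ⟨0, by simp [hx]⟩
    have hx' : ‖x‖ ≠ 0 := norm_ne_zero_iff.2 hx
    have hu : ((‖x‖ : ℂ)⁻¹ • x) ∈ sphere (0 : Fin 3 → ℂ) 1 := by
      simp [norm_smul, hx']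
    have h1 := hmin hu
    simp only [Set.mem_ofPred_eq] at h1
    obtain ⟨l, hl⟩ : ∃ l, ‖fun l => Q l x‖ ≤ ‖Q l x‖ := by
      by_contra! hcon
      exact lt_irrefl _ ((pi_norm_lt_iff (lt_of_le_of_lt (norm_nonneg _) (hcon 0))).2 hcon)
    refine ⟨l, ?_⟩
    have h2 : (fun l => Q l ((‖x‖ : ℂ)⁻¹ • x)) = ((‖x‖ : ℂ)⁻¹) ^ (m + 3) • fun l => Q l x := by
      ext l; simp [hP.grad_smul]
    rw [h2, norm_smul, norm_pow, norm_inv, Complex.norm_real, norm_norm, inv_pow] at h1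
    have h3 : 0 < ‖x‖ ^ (m + 3) := by positivity
    rw [inv_mul_eq_div, le_div_iff₀ h3] at h1
    exact h1.trans hl

lemma minors_mul_grad {h : ℂ → Fin 3 → ℂ} {w : ℂ}
    (h1 : ∑ l, Q l (h w) * h w l = 0) (h2 : ∑ l, Q l (h w) * deriv h w l = 0) (i j : Fin 3) :
    minors h w (i + 1) (i + 2) * Q j (h w) = minors h w (j + 1) (j + 2) * Q i (h w) := by
  simp only [Fin.sum_univ_three] at h1 h2
  fin_cases i <;> fin_cases j <;> simp [minors, Fin.reduceAdd]
  · linear_combination -h w 2 * h2 + deriv h w 2 * h1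
  · linear_combination h w 1 * h2 - deriv h w 1 * h1
  · linear_combination h w 2 * h2 - deriv h w 2 * h1
  · linear_combination -h w 0 * h2 + deriv h w 0 * h1
  · linear_combination -h w 1 * h2 + deriv h w 1 * h1
  · linear_combination h w 0 * h2 - deriv h w 0 * h1

lemma eventually_zero (hP : IsSmoothPlaneCurve m P Q) {f h : ℂ → Fin 3 → ℂ} {w₀ : ℂ}
    (hf : ∀ w, P (f w) = 0) (hh : IsLiftAt f h w₀) : ∀ᶠ w in 𝓝 w₀, P (h w) = 0 := by
  filter_upwards [hh.eventually_zero_iff hP.map_smul_eq_zero_iff] with w hw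
  exact hw.1 (hf w)

lemma orthogonal (hP : IsSmoothPlaneCurve m P Q) {f h : ℂ → Fin 3 → ℂ} {w₀ : ℂ}
    (hf : ∀ w, P (f w) = 0) (hh : IsLiftAt f h w₀) :
    ∑ l, Q l (h w₀) * h w₀ l = 0 ∧ ∑ l, Q l (h w₀) * deriv h w₀ l = 0 := by
  have h0 := hP.eventually_zero hf hh
  refine ⟨hP.euler _ h0.self_of_nhds, ?_⟩
  have h1 := hP.hasDerivAt_comp h _ w₀ hh.analyticAt.differentiableAt.hasDerivAt
  have h2 : (fun z => P (h z)) =ᶠ[𝓝 w₀] fun _ => 0 := h0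
  rw [← h1.deriv, h2.deriv_eq, deriv_const]

/-- In terms of a lift, the form attached to the adjoint monomial `x i ^ m * x j`. -/
noncomputable def adjointForm (m : ℕ) (Q : Fin 3 → (Fin 3 → ℂ) → ℂ) (h : ℂ → Fin 3 → ℂ)
    (l : Fin 3) (w : ℂ) (i j : Fin 3) : ℂ :=
  h w i ^ m * h w j * (minors h w (l + 1) (l + 2) / Q l (h w))

lemma adjointForm_eq (hP : IsSmoothPlaneCurve m P Q) {f h k : ℂ → Fin 3 → ℂ} {w : ℂ}
    (hf : ∀ w, P (f w) = 0) (hh : IsLiftAt f h w) (hk : IsLiftAt f k w) {l l' : Fin 3}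
    (hl : Q l (h w) ≠ 0) (hl' : Q l' (k w) ≠ 0) :
    adjointForm m Q h l w = adjointForm m Q k l' w := by
  obtain ⟨c, hc, hc0, e⟩ := hh.eventually_eq_smul hk
  have h1 := minors_eq_of_eventually_eq_smul hc.differentiableAt hk.analyticAt.differentiableAt e
  have h2 := hP.orthogonal hf hk
  have h3 := minors_mul_grad h2.1 h2.2 l l'
  have hl2 : Q l (k w) ≠ 0 := by
    intro h0; apply hl; rw [e.self_of_nhds, hP.grad_smul, h0, mul_zero]
  ext i j
  have h4 : minors k w (l + 1) (l + 2) / Q l (k w)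
      = minors k w (l' + 1) (l' + 2) / Q l' (k w) := by
    field_simp; linear_combination h3
  simp only [adjointForm, h1, ← h4, e.self_of_nhds, hP.grad_smul, Pi.smul_apply, smul_eq_mul]
  field_simp
  ring

lemma wronskian_adjointForm {h : ℂ → Fin 3 → ℂ} {φ : ℂ → ℂ} {w : ℂ}
    (hh : DifferentiableAt ℂ h w) (hφ : DifferentiableAt ℂ φ w) (a b : Fin 3) :
    (φ w * h w a) * deriv (fun z => φ z * h z b) w - (φ w * h w b) * deriv (fun z => φ z * h z a) w
      = φ w ^ 2 * minors h w a b := by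
  have h1 := hasDerivAt_pi.1 hh.hasDerivAt
  rw [(hφ.hasDerivAt.fun_mul (h1 a)).deriv, (hφ.hasDerivAt.fun_mul (h1 b)).deriv, minors]
  ring

/-- A smooth plane curve of degree at least four contains no nonconstant entire curve. -/
theorem proportional (hP : IsSmoothPlaneCurve m P Q) {f : ℂ → Fin 3 → ℂ} (hf : IsProjHol f)
    (hf0 : ∀ w, P (f w) = 0) (w w' : ℂ) : Proportional (f w) (f w') := by
  choose h hh using hf
  choose l hl using fun w => hP.grad_ne_zero (h w w) (hh w).ne_zero
  set H : ℂ → Fin 3 → Fin 3 → ℂ := fun w => adjointForm m Q (h w) (l w) w with hH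
  have hloc : ∀ w₀, ∀ᶠ w in 𝓝 w₀, H w = adjointForm m Q (h w₀) (l w₀) w := by
    intro w₀
    have := ((hP.grad_differentiable (l w₀)).continuous.continuousAt.comp
      (hh w₀).analyticAt.continuousAt).eventually_ne (hl w₀)
    filter_upwards [(hh w₀).eventually_isLiftAt, this] with w h1 h2
    exact hP.adjointForm_eq hf0 (hh w) h1 (hl w) h2
  have hΩ : ∀ w₀, DifferentiableAt ℂ (fun w => minors (h w₀) w (l w₀ + 1) (l w₀ + 2)
      / Q (l w₀) (h w₀ w)) w₀ := by
    intro w₀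
    have h1 := (hh w₀).analyticAt.differentiableAt
    have h2 := (hh w₀).analyticAt.deriv.differentiableAt
    refine DifferentiableAt.div ?_ ((hP.grad_differentiable _ _).comp w₀ h1) (hl w₀)
    have h3 := differentiableAt_pi.1 h1
    have h4 := differentiableAt_pi.1 h2
    exact ((h3 _).mul (h4 _)).sub ((h3 _).mul (h4 _))
  have hφ : ∀ w₀ i, DifferentiableAt ℂ (fun w => h w₀ w i ^ m *
      (minors (h w₀) w (l w₀ + 1) (l w₀ + 2) / Q (l w₀) (h w₀ w))) w₀ := fun w₀ i =>
    ((differentiableAt_pi.1 (hh w₀).analyticAt.differentiableAt i).pow m).mul (hΩ w₀)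
  have hHc : ∀ w₀ i j, (fun w => H w i j) =ᶠ[𝓝 w₀] fun w => h w₀ w i ^ m *
      (minors (h w₀) w (l w₀ + 1) (l w₀ + 2) / Q (l w₀) (h w₀ w)) * h w₀ w j := by
    intro w₀ i j
    filter_upwards [hloc w₀] with w hw
    rw [hw, adjointForm]; ring
  have hHd : Differentiable ℂ H := by
    intro w₀
    refine differentiableAt_pi.2 fun i => differentiableAt_pi.2 fun j => ?_
    exact ((hφ w₀ i).mul
      (differentiableAt_pi.1 (hh w₀).analyticAt.differentiableAt j)).congr_of_eventuallyEq
      (hHc w₀ i j)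
  have hdH : ∀ w i j, deriv (fun z => H z i j) w = deriv H w i j := by
    intro w i j
    have h1 := hasDerivAt_pi.1 (hHd w).hasDerivAt i
    exact (hasDerivAt_pi.1 h1 j).deriv
  obtain ⟨c, hc, hQ⟩ := hP.exists_grad_lower_bound
  have hΩQ : ∀ w a, minors (h w) w (a + 1) (a + 2) =
      minors (h w) w (l w + 1) (l w + 2) / Q (l w) (h w w) * Q a (h w w) := by
    intro w a
    have h2 := hP.orthogonal hf0 (hh w)
    have h3 := minors_mul_grad h2.1 h2.2 a (l w)
    have := hl w
    field_simp; exact h3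
  have hH0 : ∀ w, H w = 0 := by
    refine eq_zero_of_sq_norm_le_norm_deriv hHd (c := c / 2) (by positivity) fun w => ?_
    set Ω := minors (h w) w (l w + 1) (l w + 2) / Q (l w) (h w w) with hΩdef
    set N := ‖h w w‖ with hN
    obtain ⟨i, hi⟩ := exists_norm_apply_eq (h w w)
    obtain ⟨a, ha⟩ := hQ (h w w)
    have hle : ‖H w‖ ≤ N ^ (m + 1) * ‖Ω‖ := by
      refine (pi_norm_le_iff_of_nonneg (by positivity)).2 fun i =>
        (pi_norm_le_iff_of_nonneg (by positivity)).2 fun j => ?_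
      simp only [hH, adjointForm, norm_mul, norm_pow, ← hΩdef, pow_succ]
      gcongr
      · exact norm_le_pi_norm _ i
      · exact norm_le_pi_norm _ j
    have hW := wronskian_adjointForm (hh w).analyticAt.differentiableAt (hφ w i) (a + 1) (a + 2)
    have hv : ∀ b, H w i b = h w w i ^ m * Ω * h w w b := fun b => (hHc w i b).self_of_nhds
    rw [← (hHc w i (a + 1)).deriv_eq, ← (hHc w i (a + 2)).deriv_eq, hdH, hdH, ← hΩdef,
      ← hv, ← hv, hΩQ w a, ← hΩdef] at hW
    have hcomp : ∀ (K : Fin 3 → Fin 3 → ℂ) i j, ‖K i j‖ ≤ ‖K‖ := fun K i j =>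
      (norm_le_pi_norm (K i) j).trans (norm_le_pi_norm K i)
    have h1 : ‖(h w w i ^ m * Ω) ^ 2 * (Ω * Q a (h w w))‖ ≤ 2 * (‖H w‖ * ‖deriv H w‖) := by
      rw [← hW]
      refine (norm_sub_le _ _).trans ?_
      rw [norm_mul, norm_mul, two_mul]
      gcongr <;> exact hcomp _ _ _
    have h2 : c * ‖H w‖ ^ 3 ≤ 2 * (‖H w‖ * ‖deriv H w‖) := by
      refine le_trans ?_ h1
      simp only [norm_mul, norm_pow, hi, ← hN]
      calc c * ‖H w‖ ^ 3 ≤ c * (N ^ (m + 1) * ‖Ω‖) ^ 3 := by gcongr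
        _ = (N ^ m * ‖Ω‖) ^ 2 * (‖Ω‖ * (c * N ^ (m + 3))) := by ring
        _ ≤ _ := by gcongr
    rcases (norm_nonneg (H w)).eq_or_lt with h0 | h0
    · rw [← h0]; simp
    · have : ‖H w‖ * (c * ‖H w‖ ^ 2) ≤ ‖H w‖ * (2 * ‖deriv H w‖) := by
        calc _ = c * ‖H w‖ ^ 3 := by ring
          _ ≤ _ := h2
          _ = _ := by ring
      have := le_of_mul_le_mul_left this h0
      linarith
  have hm : ∀ w, minors (h w) w = 0 := by
    intro w
    obtain ⟨i, hi⟩ := Function.ne_iff.1 (hh w).ne_zero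
    have h0 := congrFun (congrFun (hH0 w) i) i
    have hl0 : minors (h w) w (l w + 1) (l w + 2) / Q (l w) (h w w) = 0 := by
      simp only [hH, adjointForm, Pi.zero_apply] at h0
      exact (mul_eq_zero.1 h0).resolve_left (mul_ne_zero (pow_ne_zero _ hi) hi)
    have hz : ∀ a, minors (h w) w (a + 1) (a + 2) = 0 := fun a => by rw [hΩQ, hl0, zero_mul]
    have h0 := hz 0
    have h1 := hz 1
    have h2 := hz 2
    simp only [minors, Fin.reduceAdd] at h0 h1 h2
    ext a b
    simp only [minors, Pi.zero_apply]
    fin_cases a <;> fin_cases b <;> simp at h0 h1 h2 ⊢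
    · linear_combination h2
    · linear_combination -h1
    · linear_combination -h2
    · linear_combination h0
    · linear_combination h1
    · linear_combination -h0
  refine IsProjHol.proportional_of_minors_eq_zero (fun w => ⟨h w, hh w⟩) (hh 0) ?_ w w'
  filter_upwards [(hh 0).eventually_isLiftAt] with z hz
  obtain ⟨b, hb, -, e⟩ := hz.eventually_eq_smul (hh z)
  rw [minors_eq_of_eventually_eq_smul hb.differentiableAt (hh z).analyticAt.differentiableAt e, hm,
    smul_zero]

end IsSmoothPlaneCurve

/-- The ternary form `t ^ n - n * y ^ (n - 1) * t + x ^ n` with `n = m + 4`. -/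
noncomputable def foldForm (m : ℕ) (v : Fin 3 → ℂ) : ℂ :=
  v 0 ^ (m + 4) - (m + 4) * v 2 ^ (m + 3) * v 0 + v 1 ^ (m + 4)

lemma isSmoothPlaneCurve_foldForm (m : ℕ) :
    IsSmoothPlaneCurve m (foldForm m) ![fun v => (m + 4) * (v 0 ^ (m + 3) - v 2 ^ (m + 3)),
      fun v => (m + 4) * v 1 ^ (m + 3), fun v => -((m + 4) * (m + 3) * v 2 ^ (m + 2) * v 0)] where
  hasDerivAt_comp g g' w hg := by
    have h := hasDerivAt_pi.1 hg
    have h1 := (((h 0).fun_pow (m + 4)).fun_sub ((((h 2).fun_pow (m + 3)).const_mul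
      ((m : ℂ) + 4)).fun_mul (h 0))).fun_add ((h 1).fun_pow (m + 4))
    refine h1.congr_deriv ?_
    simp only [Fin.sum_univ_three, Matrix.cons_val]
    push_cast
    ring
  map_smul c x := by simp only [foldForm, Pi.smul_apply, smul_eq_mul]; ring
  euler x hx := by
    simp only [foldForm] at hx
    simp only [Fin.sum_univ_three, Matrix.cons_val]
    linear_combination ((m : ℂ) + 4) * hx
  grad_differentiable l := by fin_cases l <;> simp <;> fun_prop
  grad_smul l c x := by
    fin_cases l <;> simp only [Fin.zero_eta, Fin.mk_one, Fin.reduceFinMk, Matrix.cons_val,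
      Pi.smul_apply, smul_eq_mul] <;> ring
  grad_ne_zero x hx := by
    by_contra! h
    have h0 := h 0
    have h1 := h 1
    have h2 := h 2
    have e4 : ((m : ℂ) + 4) ≠ 0 := by exact_mod_cast (by omega : m + 4 ≠ 0)
    have e3 : ((m : ℂ) + 3) ≠ 0 := by exact_mod_cast (by omega : m + 3 ≠ 0)
    simp only [Matrix.cons_val] at h0 h1 h2
    have x1 : x 1 = 0 := by simpa [e4] using h1
    have h0' : x 0 ^ (m + 3) = x 2 ^ (m + 3) := by
      simpa [e4, sub_eq_zero] using h0
    have h2' : x 2 = 0 ∨ x 0 = 0 := by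
      simpa [e4, e3] using h2
    apply hx
    ext l
    rcases h2' with h2' | h2' <;> rw [h2', zero_pow (by omega)] at h0'
    · fin_cases l <;> simp [x1, h2', pow_eq_zero_iff (by omega) |>.1 h0']
    · fin_cases l <;> simp [x1, h2', pow_eq_zero_iff (by omega) |>.1 h0'.symm]

lemma isSmoothPlaneCurve_fermat :
    IsSmoothPlaneCurve 0 (fun v => v 0 ^ 4 + v 1 ^ 4 - v 2 ^ 4) ![fun v => 4 * v 0 ^ 3,
      fun v => 4 * v 1 ^ 3, fun v => -(4 * v 2 ^ 3)] where
  hasDerivAt_comp g g' w hg := by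
    have h := hasDerivAt_pi.1 hg
    have h1 := (((h 0).fun_pow 4).fun_add ((h 1).fun_pow 4)).fun_sub ((h 2).fun_pow 4)
    refine h1.congr_deriv ?_
    simp only [Fin.sum_univ_three, Matrix.cons_val]
    push_cast
    ring
  map_smul c x := by simp only [Pi.smul_apply, smul_eq_mul]; ring
  euler x hx := by
    simp only [Fin.sum_univ_three, Matrix.cons_val]
    linear_combination 4 * hx
  grad_differentiable l := by fin_cases l <;> simp <;> fun_prop
  grad_smul l c x := by
    fin_cases l <;> simp only [Fin.zero_eta, Fin.mk_one, Fin.reduceFinMk, Matrix.cons_val,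
      Pi.smul_apply, smul_eq_mul] <;> ring
  grad_ne_zero x hx := by
    by_contra! h
    apply hx
    ext l
    have := h l
    fin_cases l <;> simpa using this

lemma exists_entire_pow_eq {φ : ℂ → ℂ} (hφ : Differentiable ℂ φ) (h0 : ∀ w, φ w ≠ 0)
    {n : ℕ} (hn : n ≠ 0) : ∃ ψ : ℂ → ℂ, Differentiable ℂ ψ ∧ ∀ w, ψ w ^ n = φ w := by
  have hd : Differentiable ℂ (deriv φ) := fun z => (hφ.analyticAt z).deriv.differentiableAt
  obtain ⟨L, hL0, hL⟩ := (hd.div hφ h0).isExactOn_univ.with_val_at 0 (Complex.log (φ 0))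
  replace hL : ∀ z, HasDerivAt L (deriv φ z / φ z) z := fun z => hL z (Set.mem_univ z)
  have key : ∀ w, φ w * Complex.exp (-L w) = 1 := by
    have hder : ∀ z, HasDerivAt (fun w => φ w * Complex.exp (-L w)) 0 z := fun z => by
      refine ((hφ z).hasDerivAt.fun_mul (hL z).fun_neg.cexp).congr_deriv ?_
      have := h0 z
      field_simp
      ring
    intro w
    have := is_const_of_deriv_eq_zero (fun z => (hder z).differentiableAt)
      (fun z => (hder z).deriv) w 0
    rw [this, hL0, Complex.exp_neg, Complex.exp_log (h0 0), mul_inv_cancel₀ (h0 0)]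
  refine ⟨fun w => Complex.exp (L w / n), fun w => ((hL w).differentiableAt.div_const _).cexp,
    fun w => ?_⟩
  have hn' : (n : ℂ) ≠ 0 := Nat.cast_ne_zero.2 hn
  rw [← Complex.exp_nat_mul, mul_div_cancel₀ _ hn']
  have := key w
  rw [Complex.exp_neg] at this
  have h1 := Complex.exp_ne_zero (L w)
  field_simp at this
  exact this.symm

/-- Little Picard theorem. -/
lemma eq_of_entire_of_omits {φ : ℂ → ℂ} (hφ : Differentiable ℂ φ) (h0 : ∀ w, φ w ≠ 0)
    (h1 : ∀ w, φ w ≠ 1) (w w' : ℂ) : φ w = φ w' := by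
  obtain ⟨x, hx, hx4⟩ := exists_entire_pow_eq hφ h0 (n := 4) (by norm_num)
  obtain ⟨y, hy, hy4⟩ := exists_entire_pow_eq (φ := fun w => 1 - φ w) (by fun_prop)
    (fun w => sub_ne_zero.2 (h1 w).symm) (n := 4) (by norm_num)
  have hg : IsProjHol fun w => ![x w, y w, 1] := by
    refine IsProjHol.of_differentiable (differentiable_pi.2 fun i => ?_) fun w h => ?_
    · fin_cases i <;> simp <;> fun_prop
    · simpa using congrFun h 2
  have := isSmoothPlaneCurve_fermat.proportional hg (fun w => by simp [hx4, hy4]) w w' 0 2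
  simp only [Matrix.cons_val, mul_one, one_mul] at this
  rw [← hx4, ← hx4, this]

/-- An entire curve in the projective line omitting three points is constant. -/
lemma IsProjHol.proportional_of_omits {f : ℂ → Fin 2 → ℂ} (hf : IsProjHol f) {t₁ t₂ t₃ : ℂ}
    (h12 : t₁ ≠ t₂) (h13 : t₁ ≠ t₃) (h23 : t₂ ≠ t₃) (h1 : ∀ w, f w 1 ≠ t₁ * f w 0)
    (h2 : ∀ w, f w 1 ≠ t₂ * f w 0) (h3 : ∀ w, f w 1 ≠ t₃ * f w 0) (w w' : ℂ) :
    Proportional (f w) (f w') := by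
  have e1 := fun w => sub_ne_zero.2 (h1 w)
  have e2 := fun w => sub_ne_zero.2 (h2 w)
  have e12 := sub_ne_zero.2 h12
  have e13 := sub_ne_zero.2 h13.symm
  have e23 := sub_ne_zero.2 h23.symm
  set κ : ℂ := (t₃ - t₂) / (t₃ - t₁) with hκ
  have hκ0 : κ ≠ 0 := div_ne_zero e23 e13
  set φ : ℂ → ℂ := fun w => κ * ((f w 1 - t₁ * f w 0) / (f w 1 - t₂ * f w 0)) with hφ
  have hd : Differentiable ℂ φ := by
    intro w₀
    obtain ⟨h, hh⟩ := hf w₀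
    have hc : ∀ᶠ w in 𝓝 w₀, φ w = κ * ((h w 1 - t₁ * h w 0) / (h w 1 - t₂ * h w 0)) := by
      filter_upwards [hh.eventually_isLiftAt] with w hw
      obtain ⟨c, hc, e⟩ := hw.exists_smul
      have : ∀ t, f w 1 - t * f w 0 = c * (h w 1 - t * h w 0) := fun t => by
        rw [e]; simp only [Pi.smul_apply, smul_eq_mul]; ring
      simp only [hφ, this]
      rw [mul_div_mul_left _ _ hc]
    refine DifferentiableAt.congr_of_eventuallyEq ?_ hc
    have hp := differentiableAt_pi.1 hh.analyticAt.differentiableAt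
    refine DifferentiableAt.const_mul (DifferentiableAt.div ((hp 1).sub ((hp 0).const_mul t₁))
      ((hp 1).sub ((hp 0).const_mul t₂)) fun h0 => ?_) κ
    obtain ⟨c, hc, e⟩ := hh.exists_smul
    apply e2 w₀
    rw [e]
    replace h0 : h w₀ 1 - t₂ * h w₀ 0 = 0 := h0
    simp only [Pi.smul_apply, smul_eq_mul]
    linear_combination c * h0
  have hom1 : ∀ w, φ w ≠ 1 := by
    intro w hw
    simp only [hφ, hκ] at hw
    have := e2 w
    field_simp at hw
    apply h3 w
    apply mul_left_cancel₀ e12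
    linear_combination hw
  have hc := eq_of_entire_of_omits hd (fun w => mul_ne_zero hκ0 (div_ne_zero (e1 w) (e2 w)))
    hom1 w w'
  have := mul_left_cancel₀ hκ0 hc
  rw [div_eq_div_iff (e2 w) (e2 w')] at this
  have h01 : f w 0 * f w' 1 = f w 1 * f w' 0 := by
    apply mul_left_cancel₀ e12
    linear_combination -this
  intro a b
  fin_cases a <;> fin_cases b <;> simp
  · exact h01
  · exact h01.symm

section Projection

variable {ι κ : Type*}

lemma Proportional.comp {x y : ι → ℂ} (h : Proportional x y) (σ : κ → ι) :
    Proportional (x ∘ σ) (y ∘ σ) := fun a b => h (σ a) (σ b)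

variable [Fintype ι] [Fintype κ] {f : ℂ → ι → ℂ}

lemma analyticAt_comp_index {h : ℂ → ι → ℂ} {w : ℂ} (hh : AnalyticAt ℂ h w) (σ : κ → ι) :
    AnalyticAt ℂ (fun z => h z ∘ σ) w :=
  analyticAt_pi_iff.2 fun a => (analyticAt_pi_iff.1 hh) (σ a)

/-- Projecting away from a coordinate subspace that the curve avoids. -/
lemma IsProjHol.comp_of_ne_zero (hf : IsProjHol f) (σ : κ → ι) (h0 : ∀ w, f w ∘ σ ≠ 0) :
    IsProjHol fun w => f w ∘ σ := fun w₀ => by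
  obtain ⟨h, hh⟩ := hf w₀
  refine ⟨fun z => h z ∘ σ, analyticAt_comp_index hh.analyticAt σ, ?_, ?_⟩
  · obtain ⟨c, hc, e⟩ := hh.exists_smul
    intro h1
    apply h0 w₀
    rw [e]
    funext a
    have := congrFun h1 a
    simp only [Function.comp_apply, Pi.zero_apply, Pi.smul_apply, smul_eq_mul] at this ⊢
    rw [this, mul_zero]
  · filter_upwards [hh.eventually] with w hw
    exact ⟨h0 w, hw.2.comp σ⟩

/-- The projection of a curve away from a coordinate subspace extends across the points where the
curve meets that subspace. -/
lemma IsProjHol.exists_projection (hf : IsProjHol f) (σ : κ → ι) {w₁ : ℂ}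
    (h₁ : f w₁ ∘ σ ≠ 0) :
    ∃ q : ℂ → κ → ℂ, IsProjHol q ∧ ∀ w, Proportional (f w ∘ σ) (q w) := by
  have hnz : ∀ w₀ h, IsLiftAt f h w₀ → ¬ ∀ᶠ z in 𝓝 w₀, h z ∘ σ = 0 := by
    intro w₀ h hh hz
    apply h₁
    funext a
    refine hf.forall_eq_zero (φ := fun x => x (σ a)) (by fun_prop) ?_ (w₀ := w₀) ?_ w₁
    · intro c hc x; simp [hc]
    · filter_upwards [hz, hh.eventually_isLiftAt] with w hw hw'
      obtain ⟨c, hc, e⟩ := hw'.exists_smul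
      have := congrFun hw a
      simp only [Function.comp_apply, Pi.zero_apply] at this
      rw [e, Pi.smul_apply, this, smul_zero]
  choose h hh using hf
  have := fun w => ((analyticAt_comp_index (hh w).analyticAt
    σ).exists_eventuallyEq_pow_smul_nonzero_iff).2 (hnz w _ (hh w))
  choose k q hq hq0 he using this
  have hp : ∀ w, Proportional (f w ∘ σ) (q w w) := by
    intro w a b
    obtain ⟨c, -, e⟩ := (hh w).exists_smul
    have h1 := (he w).self_of_nhds
    have h2 : ∀ a, f w (σ a) = c * ((w - w) ^ k w * q w w a) := fun a => by
      rw [e]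
      simpa using congrArg (c * ·) (congrFun h1 a)
    simp only [Function.comp_apply, h2]
    ring
  refine ⟨fun w => q w w, fun w₀ => ⟨q w₀, hq w₀, hq0 w₀, ?_⟩, hp⟩
  filter_upwards [he w₀, (hh w₀).eventually_isLiftAt,
    (hq w₀).continuousAt.eventually_ne (hq0 w₀)] with w h1 h2 h3
  refine ⟨hq0 w, ?_⟩
  rcases eq_or_ne w w₀ with rfl | hne
  · exact fun a b => mul_comm _ _
  have h4 : h w₀ w ∘ σ ≠ 0 := by
    rw [h1]
    exact smul_ne_zero (pow_ne_zero _ (sub_ne_zero.2 hne)) h3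
  obtain ⟨c, hc, e⟩ := h2.exists_smul
  have h5 : f w ∘ σ = c • (h w₀ w ∘ σ) := by rw [e]; rfl
  have h6 : f w ∘ σ ≠ 0 := by rw [h5]; exact smul_ne_zero hc h4
  have h7 : Proportional (f w ∘ σ) (q w₀ w) := by
    rw [h5, h1, smul_smul]; exact proportional_smul_left _
  exact (hp w).symm.trans h7 h6

end Projection

/-- The projection to the plane of a curve lying on a cone over a smooth plane curve of degree at
least four is constant. -/
lemma IsSmoothPlaneCurve.exists_proportional_comp {ι : Type*} [Fintype ι] {m : ℕ}
    {P : (Fin 3 → ℂ) → ℂ} {Q : Fin 3 → (Fin 3 → ℂ) → ℂ} (hP : IsSmoothPlaneCurve m P Q)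
    (hPd : Differentiable ℂ P) {f : ℂ → ι → ℂ} (hf : IsProjHol f) (σ : Fin 3 → ι)
    (h0 : ∀ w, P (f w ∘ σ) = 0) :
    (∀ w, f w ∘ σ = 0) ∨ ∃ c, c ≠ 0 ∧ P c = 0 ∧ ∀ w, Proportional (f w ∘ σ) c := by
  by_cases h : ∀ w, f w ∘ σ = 0
  · exact Or.inl h
  push Not at h
  obtain ⟨w₁, hw₁⟩ := h
  obtain ⟨q, hq, hp⟩ := hf.exists_projection σ hw₁
  have hPq : ∀ w, P (q w) = 0 := by
    refine hq.forall_eq_zero hPd hP.map_smul_eq_zero_iff (w₀ := w₁) ?_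
    obtain ⟨k, hk⟩ := hf w₁
    have hk1 : k w₁ ∘ σ ≠ 0 := by
      obtain ⟨c, hc, e⟩ := hk.exists_smul
      intro h1
      apply hw₁
      rw [e]
      funext a
      have := congrFun h1 a
      simp only [Function.comp_apply, Pi.zero_apply, Pi.smul_apply, smul_eq_mul] at this ⊢
      rw [this, mul_zero]
    filter_upwards [hk.eventually_isLiftAt,
      (analyticAt_comp_index hk.analyticAt σ).continuousAt.eventually_ne hk1] with w h1 h2
    obtain ⟨c, hc, e⟩ := h1.exists_smul
    have h5 : f w ∘ σ = c • (k w ∘ σ) := by rw [e]; rfl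
    have h6 : f w ∘ σ ≠ 0 := by rw [h5]; exact smul_ne_zero hc h2
    obtain ⟨t, ht, e'⟩ := (hp w).exists_smul h6 (hq.ne_zero w)
    have := h0 w
    rwa [e', hP.map_smul_eq_zero_iff t ht] at this
  refine Or.inr ⟨q 0, hq.ne_zero 0, hPq 0, fun w => ?_⟩
  exact (hp w).trans (hP.proportional hq hPq w 0) (hq.ne_zero w)

/-- The restriction of `foldForm` to a line through the vertex. -/
noncomputable def foldPolynomial (k : ℕ) (x y : ℂ) : Polynomial ℂ :=
  Polynomial.X ^ (k + 4) + (Polynomial.C (-((k + 4) * y ^ (k + 3))) * Polynomial.X +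
    Polynomial.C (x ^ (k + 4)))

section Roots

variable (k : ℕ) (x y : ℂ)

lemma eval_foldPolynomial (t : ℂ) : (foldPolynomial k x y).eval t = foldForm k ![t, x, y] := by
  simp [foldPolynomial, foldForm]; ring

lemma eval_derivative_foldPolynomial (t : ℂ) : (foldPolynomial k x y).derivative.eval t =
    (k + 4) * (t ^ (k + 3) - y ^ (k + 3)) := by
  simp only [foldPolynomial, Polynomial.derivative_add, Polynomial.derivative_X_pow,
    Polynomial.derivative_C_mul, Polynomial.derivative_X, Polynomial.derivative_C]
  simp; ring

lemma eval_iterate_derivative_foldPolynomial (t : ℂ) :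
    (Polynomial.derivative^[2] (foldPolynomial k x y)).eval t =
      (k + 4) * (k + 3) * t ^ (k + 2) := by
  simp only [foldPolynomial, Polynomial.derivative_add, Polynomial.derivative_X_pow,
    Polynomial.derivative_C_mul, Polynomial.derivative_X, Polynomial.derivative_C,
    Function.iterate_succ, Function.iterate_zero, Function.comp_apply, id, mul_one, add_zero]
  simp; ring

lemma degree_foldPolynomial_tail : (Polynomial.C (-((k + 4) * y ^ (k + 3))) * Polynomial.X +
    Polynomial.C (x ^ (k + 4))).degree < ((k + 4 : ℕ) : WithBot ℕ) :=
  lt_of_le_of_lt Polynomial.degree_linear_le (by exact_mod_cast (by omega : 1 < k + 4))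

lemma monic_foldPolynomial : (foldPolynomial k x y).Monic :=
  Polynomial.monic_X_pow_add (degree_foldPolynomial_tail k x y)

lemma natDegree_foldPolynomial : (foldPolynomial k x y).natDegree = k + 4 :=
  Polynomial.natDegree_eq_of_degree_eq_some
    ((Polynomial.degree_add_eq_left_of_degree_lt (by
      rw [Polynomial.degree_X_pow]; exact degree_foldPolynomial_tail k x y)).trans
        (Polynomial.degree_X_pow _))

variable {k x y}

lemma double_root_eq {t : ℂ} (h0 : foldForm k ![t, x, y] = 0) (h1 : t ^ (k + 3) = y ^ (k + 3)) :
    (k + 3) * y ^ (k + 3) * t = x ^ (k + 4) := by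
  simp only [foldForm, Matrix.cons_val] at h0
  linear_combination -h0 + t * h1

lemma ne_zero_of_double_root (hxy : x ≠ 0 ∨ y ≠ 0) {t : ℂ} (h0 : foldForm k ![t, x, y] = 0)
    (h1 : t ^ (k + 3) = y ^ (k + 3)) : y ≠ 0 ∧ t ≠ 0 := by
  have h2 := double_root_eq h0 h1
  have hy : y ≠ 0 := by
    rintro rfl
    rw [zero_pow (by omega), mul_zero, zero_mul, eq_comm, pow_eq_zero_iff (by omega)] at h2
    rcases hxy with h | h
    · exact h h2
    · exact h rfl
  refine ⟨hy, ?_⟩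
  rintro rfl
  rw [zero_pow (by omega)] at h1
  exact hy (pow_eq_zero_iff (by omega) |>.1 h1.symm)

lemma double_root_unique (hxy : x ≠ 0 ∨ y ≠ 0) {t s : ℂ} (h0 : foldForm k ![t, x, y] = 0)
    (h1 : t ^ (k + 3) = y ^ (k + 3)) (h0' : foldForm k ![s, x, y] = 0)
    (h1' : s ^ (k + 3) = y ^ (k + 3)) : t = s := by
  have hy := (ne_zero_of_double_root hxy h0 h1).1
  have e3 : ((k : ℂ) + 3) ≠ 0 := by exact_mod_cast (by omega : k + 3 ≠ 0)
  have e : ((k : ℂ) + 3) * y ^ (k + 3) ≠ 0 := mul_ne_zero e3 (pow_ne_zero _ hy)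
  exact mul_left_cancel₀ e ((double_root_eq h0 h1).trans (double_root_eq h0' h1').symm)

lemma count_roots_foldPolynomial_le_one {t : ℂ} (h : t ^ (k + 3) ≠ y ^ (k + 3)) :
    (foldPolynomial k x y).roots.count t ≤ 1 := by
  rw [Polynomial.count_roots]
  by_contra! hc
  rw [Polynomial.one_lt_rootMultiplicity_iff_isRoot (monic_foldPolynomial k x y).ne_zero] at hc
  have h1 := hc.2
  have e4 : ((k : ℂ) + 4) ≠ 0 := by exact_mod_cast (by omega : k + 4 ≠ 0)
  rw [Polynomial.IsRoot, eval_derivative_foldPolynomial, mul_eq_zero, sub_eq_zero] at h1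
  exact h (h1.resolve_left e4)

lemma count_roots_foldPolynomial_le_two (hxy : x ≠ 0 ∨ y ≠ 0) (t : ℂ) :
    (foldPolynomial k x y).roots.count t ≤ 2 := by
  by_cases h1 : t ^ (k + 3) = y ^ (k + 3)
  swap
  · exact (count_roots_foldPolynomial_le_one h1).trans one_le_two
  rw [Polynomial.count_roots]
  by_contra! hc
  rw [Polynomial.lt_rootMultiplicity_iff_isRoot_iterate_derivative
    (monic_foldPolynomial k x y).ne_zero] at hc
  have h0 := hc 0 (by norm_num)
  have h2 := hc 2 le_rfl
  rw [Polynomial.IsRoot, eval_iterate_derivative_foldPolynomial] at h2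
  rw [Function.iterate_zero, id, Polynomial.IsRoot, eval_foldPolynomial] at h0
  have e4 : ((k : ℂ) + 4) ≠ 0 := by exact_mod_cast (by omega : k + 4 ≠ 0)
  have e3 : ((k : ℂ) + 3) ≠ 0 := by exact_mod_cast (by omega : k + 3 ≠ 0)
  simp only [mul_eq_zero, e4, e3, false_or] at h2
  exact (ne_zero_of_double_root hxy h0 h1).2 (pow_eq_zero_iff (by omega) |>.1 h2)

lemma card_le_toFinset_roots_foldPolynomial (hxy : x ≠ 0 ∨ y ≠ 0) :
    k + 4 ≤ (foldPolynomial k x y).roots.toFinset.card + 1 := by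
  classical
  have hc : (foldPolynomial k x y).roots.card = k + 4 := by
    rw [IsAlgClosed.card_roots_eq_natDegree, natDegree_foldPolynomial]
  rw [← hc, ← Multiset.toFinset_sum_count_eq]
  set S := (foldPolynomial k x y).roots.toFinset with hS
  by_cases h : ∃ t ∈ S, t ^ (k + 3) = y ^ (k + 3)
  · obtain ⟨t, ht, h1⟩ := h
    have hroot : ∀ s ∈ S, foldForm k ![s, x, y] = 0 := by
      intro s hs
      rw [hS, Multiset.mem_toFinset, Polynomial.mem_roots (monic_foldPolynomial k x y).ne_zero,
        Polynomial.IsRoot, eval_foldPolynomial] at hs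
      exact hs
    rw [← Finset.add_sum_erase S _ ht]
    have h2 : ∑ s ∈ S.erase t, (foldPolynomial k x y).roots.count s ≤ ∑ s ∈ S.erase t, 1 := by
      refine Finset.sum_le_sum fun s hs => count_roots_foldPolynomial_le_one fun h3 => ?_
      rw [Finset.mem_erase] at hs
      exact hs.1 (double_root_unique hxy (hroot s hs.2) h3 (hroot t ht) h1)
    have h3 := count_roots_foldPolynomial_le_two (k := k) hxy t
    rw [Finset.sum_const, smul_eq_mul, mul_one] at h2
    have := Finset.card_erase_add_one ht
    omega
  · push Not at h
    have : ∑ s ∈ S, (foldPolynomial k x y).roots.count s ≤ ∑ s ∈ S, 1 :=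
      Finset.sum_le_sum fun s hs => count_roots_foldPolynomial_le_one (h s hs)
    simp only [Finset.sum_const, smul_eq_mul, mul_one] at this
    omega

/-- At least three points of the fibre differ from a given point which is not on a ramified
fibre. -/
lemma exists_three_roots (hxy : x ≠ 0 ∨ y ≠ 0) (e : ℂ)
    (he : foldForm k ![e, x, y] = 0 → ∀ t, foldForm k ![t, x, y] = 0 → t ^ (k + 3) ≠ y ^ (k + 3)) :
    ∃ S : Finset ℂ, 3 ≤ S.card ∧ ∀ t ∈ S, foldForm k ![t, x, y] = 0 ∧ t ≠ e := by
  classical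
  have hroot : ∀ s ∈ (foldPolynomial k x y).roots.toFinset, foldForm k ![s, x, y] = 0 := by
    intro s hs
    rw [Multiset.mem_toFinset, Polynomial.mem_roots (monic_foldPolynomial k x y).ne_zero,
      Polynomial.IsRoot, eval_foldPolynomial] at hs
    exact hs
  refine ⟨(foldPolynomial k x y).roots.toFinset.erase e, ?_, fun t ht => ?_⟩
  · by_cases h : foldForm k ![e, x, y] = 0
    · have hc : (foldPolynomial k x y).roots.card = k + 4 := by
        rw [IsAlgClosed.card_roots_eq_natDegree, natDegree_foldPolynomial]
      have hs : ∑ s ∈ (foldPolynomial k x y).roots.toFinset, (foldPolynomial k x y).roots.count s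
          ≤ ∑ s ∈ (foldPolynomial k x y).roots.toFinset, 1 :=
        Finset.sum_le_sum fun s hs => count_roots_foldPolynomial_le_one (he h s (hroot s hs))
      rw [Multiset.toFinset_sum_count_eq, hc, Finset.sum_const, smul_eq_mul, mul_one] at hs
      have := Finset.pred_card_le_card_erase (s := (foldPolynomial k x y).roots.toFinset) (a := e)
      omega
    · rw [Finset.erase_eq_of_notMem fun h' => h (hroot e h')]
      have := card_le_toFinset_roots_foldPolynomial (k := k) hxy
      omega
  · rw [Finset.mem_erase] at ht
    exact ⟨hroot t ht.2, ht.1⟩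

lemma exists_three_nonroots (k : ℕ) (x y : ℂ) :
    ∃ S : Finset ℂ, 3 ≤ S.card ∧ ∀ t ∈ S, foldForm k ![t, x, y] ≠ 0 := by
  have hinf : {t : ℂ | foldForm k ![t, x, y] ≠ 0}.Infinite := by
    refine Set.Finite.infinite_compl (s := {t : ℂ | foldForm k ![t, x, y] = 0}) ?_
    refine ((foldPolynomial k x y).roots.toFinset.finite_toSet).subset fun t ht => ?_
    rw [Finset.mem_coe, Multiset.mem_toFinset,
      Polynomial.mem_roots (monic_foldPolynomial k x y).ne_zero, Polynomial.IsRoot,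
      eval_foldPolynomial]
    exact ht
  obtain ⟨S, hS, hc⟩ := hinf.exists_subset_card_eq 3
  exact ⟨S, hc.ge, fun t ht => hS ht⟩

end Roots

/-- Neither form has a multiple root over a point `[x : y]` where roots of both forms are related
by the factor `lam`. -/
def SeparatesRamification (p q : ℕ) (lam : ℂ) : Prop :=
  ∀ t x y : ℂ, (x ≠ 0 ∨ y ≠ 0) → foldForm p ![t, x, y] = 0 → foldForm q ![lam * t, x, y] = 0 →
    ∀ s, foldForm q ![s, x, y] = 0 → s ^ (q + 3) ≠ y ^ (q + 3)

lemma foldForm_smul (k : ℕ) (c : ℂ) (v : Fin 3 → ℂ) :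
    foldForm k (c • v) = c ^ (k + 4) * foldForm k v :=
  (isSmoothPlaneCurve_foldForm k).map_smul c v

lemma differentiable_foldForm (k : ℕ) : Differentiable ℂ (foldForm k) := by
  unfold foldForm; fun_prop

/-- Entire curves on the cone over a plane curve are constant when they meet a second cone only
along a plane, or not at all, or lie in it. -/
lemma IsProjHol.proportional_of_cone {p q : ℕ} {lam : ℂ} (hlam : SeparatesRamification p q lam)
    {f : ℂ → Fin 4 → ℂ} (hf : IsProjHol f) (hA : ∀ w, foldForm p ![f w 0, f w 1, f w 2] = 0)
    (hB : (∀ w, foldForm q ![f w 3, f w 1, f w 2] = 0) ∨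
      ∀ w, foldForm q ![f w 3, f w 1, f w 2] = 0 → f w 3 = lam * f w 0) (w w' : ℂ) :
    Proportional (f w) (f w') := by
  have hcomp : ∀ w, f w ∘ ![0, 1, 2] = ![f w 0, f w 1, f w 2] := fun w => by
    ext i; fin_cases i <;> rfl
  rcases (isSmoothPlaneCurve_foldForm p).exists_proportional_comp (differentiable_foldForm p) hf
    ![0, 1, 2] (fun w => by rw [hcomp]; exact hA w) with h | ⟨c, hc, hPc, hprop⟩
  · have hz : ∀ w, f w 0 = 0 ∧ f w 1 = 0 ∧ f w 2 = 0 := fun w =>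
      ⟨congrFun (h w) 0, congrFun (h w) 1, congrFun (h w) 2⟩
    obtain ⟨a0, a1, a2⟩ := hz w
    obtain ⟨b0, b1, b2⟩ := hz w'
    intro a b
    fin_cases a <;> fin_cases b <;> simp [a0, a1, a2, b0, b1, b2]
  have hc12 : c 1 ≠ 0 ∨ c 2 ≠ 0 := by
    by_contra! hcon
    apply hc
    have : c 0 = 0 := by simpa [foldForm, hcon.1, hcon.2] using hPc
    ext i; fin_cases i <;> simp [this, hcon.1, hcon.2]
  have hPc' : foldForm p ![c 0, c 1, c 2] = 0 := by
    convert hPc; ext i; fin_cases i <;> rfl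
  obtain ⟨j, hj⟩ := Function.ne_iff.1 hc
  simp only [Pi.zero_apply] at hj
  set σ : Fin 3 → Fin 4 := ![0, 1, 2] with hσ
  have hs : ∀ w a, f w (σ a) = f w (σ j) / c j * c a := fun w a => by
    have := hprop w a j
    simp only [Function.comp_apply] at this
    field_simp
    linear_combination this
  have hF0 : ∀ w, f w ∘ ![σ j, 3] ≠ 0 := by
    intro w h0
    have h1 : f w (σ j) = 0 := congrFun h0 0
    have h2 : f w 3 = 0 := congrFun h0 1
    apply hf.ne_zero w
    have h3 : ∀ a, f w (σ a) = 0 := fun a => by rw [hs, h1]; simp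
    ext i
    fin_cases i
    exacts [h3 0, h3 1, h3 2, h2]
  have hF := hf.comp_of_ne_zero ![σ j, 3] hF0
  have hroot : ∀ w t, f w 3 = t * (f w (σ j) / c j) → f w (σ j) ≠ 0 ∧
      (foldForm q ![f w 3, f w 1, f w 2] = 0 ↔ foldForm q ![t, c 1, c 2] = 0) := by
    intro w t ht
    have h1 : f w (σ j) ≠ 0 := by
      intro h1
      apply hF0 w
      rw [h1, zero_div, mul_zero] at ht
      ext i
      fin_cases i
      exacts [h1, ht]
    refine ⟨h1, ?_⟩
    have : ![f w 3, f w 1, f w 2] = (f w (σ j) / c j) • ![t, c 1, c 2] := by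
      ext i
      fin_cases i
      · simpa [mul_comm] using ht
      · exact hs w 1
      · exact hs w 2
    rw [this, foldForm_smul]
    simp [h1, hj]
  obtain ⟨S, hS3, hS⟩ : ∃ S : Finset ℂ, 3 ≤ S.card ∧
      ∀ t ∈ S, ∀ w, f w 3 ≠ t * (f w (σ j) / c j) := by
    rcases hB with hB | hB
    · obtain ⟨S, hS3, hS⟩ := exists_three_nonroots q (c 1) (c 2)
      exact ⟨S, hS3, fun t ht w h => hS t ht (((hroot w t h).2).1 (hB w))⟩
    · obtain ⟨S, hS3, hS⟩ := exists_three_roots (k := q) hc12 (lam * c 0)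
        (fun h => hlam (c 0) (c 1) (c 2) hc12 hPc' h)
      refine ⟨S, hS3, fun t ht w h => (hS t ht).2 ?_⟩
      obtain ⟨h1, h2⟩ := hroot w t h
      have h3 := hB w (h2.2 (hS t ht).1)
      have h4 : f w 0 = f w (σ j) / c j * c 0 := hs w 0
      apply mul_right_cancel₀ (div_ne_zero h1 hj)
      rw [← h, h3, h4]; ring
  obtain ⟨t₁, t₂, t₃, m1, m2, m3, h12, h13, h23⟩ : ∃ t₁ t₂ t₃, t₁ ∈ S ∧ t₂ ∈ S ∧ t₃ ∈ S ∧
      t₁ ≠ t₂ ∧ t₁ ≠ t₃ ∧ t₂ ≠ t₃ := by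
    obtain ⟨a, b, c, h⟩ := Finset.two_lt_card_iff.1 (show 2 < S.card by omega)
    exact ⟨a, b, c, h⟩
  have hne : ∀ {a b : ℂ}, a ≠ b → a / c j ≠ b / c j := fun h h' => h (by field_simp at h'; exact h')
  have hom : ∀ t ∈ S, ∀ w, (f w ∘ ![σ j, 3]) 1 ≠ t / c j * (f w ∘ ![σ j, 3]) 0 := by
    intro t ht w h
    refine hS t ht w ?_
    have h' : f w 3 = t / c j * f w (σ j) := h
    rw [h']; ring
  have key := hF.proportional_of_omits (hne h12) (hne h13) (hne h23) (hom _ m1) (hom _ m2)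
    (hom _ m3) w w' 0 1
  replace key : f w (σ j) * f w' 3 = f w 3 * f w' (σ j) := key
  have e0 : ∀ w, f w 0 = f w (σ j) / c j * c 0 := fun w => hs w 0
  have e1 : ∀ w, f w 1 = f w (σ j) / c j * c 1 := fun w => hs w 1
  have e2 : ∀ w, f w 2 = f w (σ j) / c j * c 2 := fun w => hs w 2
  have hlin : ∀ w i, f w i = (![c 0 / c j, c 1 / c j, c 2 / c j, 0] : Fin 4 → ℂ) i * f w (σ j) +
      (![0, 0, 0, 1] : Fin 4 → ℂ) i * f w 3 := by
    intro w i
    fin_cases i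
    · exact (e0 w).trans (by simp; ring)
    · exact (e1 w).trans (by simp; ring)
    · exact (e2 w).trans (by simp; ring)
    · simp
  generalize (![c 0 / c j, c 1 / c j, c 2 / c j, 0] : Fin 4 → ℂ) = α at hlin
  generalize (![0, 0, 0, 1] : Fin 4 → ℂ) = β at hlin
  intro a b
  rw [hlin w a, hlin w b, hlin w' a, hlin w' b]
  linear_combination (α a * β b - β a * α b) * key

lemma separatesRamification_of_norm {p q : ℕ} {lam : ℂ}
    (H : ∀ t x : ℂ, 1 ≤ ‖x‖ → ‖x‖ ≤ 2 → foldForm p ![t, x, 1] = 0 →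
      foldForm q ![lam * t, x, 1] ≠ 0) : SeparatesRamification p q lam := by
  intro t x y hxy hp hq s hs hsy
  obtain ⟨hy, -⟩ := ne_zero_of_double_root hxy hs hsy
  have hdiv : ∀ k r, foldForm k ![r, x, y] = 0 → foldForm k ![r / y, x / y, 1] = 0 := by
    intro k r h
    have : ![r / y, x / y, 1] = y⁻¹ • ![r, x, y] := by
      ext i
      fin_cases i
      · simp [div_eq_inv_mul]
      · simp [div_eq_inv_mul]
      · simp [hy]
    rw [this, foldForm_smul, h, mul_zero]
  have h1 := double_root_eq (hdiv q s hs) (by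
    rw [div_pow, hsy, one_pow, div_self (pow_ne_zero _ hy)])
  have hnorm : ‖s / y‖ = 1 := by
    have : ‖s‖ ^ (q + 3) = ‖y‖ ^ (q + 3) := by rw [← norm_pow, hsy, norm_pow]
    rw [norm_div, (pow_left_inj₀ (norm_nonneg _) (norm_nonneg _) (by omega)).1 this,
      div_self (norm_ne_zero_iff.2 hy)]
  have hx : ‖x / y‖ ^ (q + 4) = q + 3 := by
    rw [← norm_pow, ← h1, one_pow, mul_one, norm_mul, hnorm, mul_one]
    exact_mod_cast Complex.norm_natCast (q + 3)
  refine H (t / y) (x / y) ?_ ?_ (hdiv p t hp) ?_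
  · by_contra! hc
    have := pow_le_one₀ (n := q + 4) (norm_nonneg _) hc.le
    rw [hx] at this
    have : (0 : ℝ) ≤ q := q.cast_nonneg
    linarith
  · by_contra! hc
    have h2 := pow_le_pow_left₀ zero_le_two hc.le (q + 4)
    rw [hx] at h2
    have h3 : ((q + 4 : ℕ) : ℝ) < 2 ^ (q + 4) := by exact_mod_cast Nat.lt_two_pow_self
    push_cast at h3
    linarith
  · have := hdiv q _ hq
    rwa [mul_div_assoc] at this

lemma foldForm_ne_zero_of_quartic {m : ℕ} {t x : ℂ} (h1 : 1 ≤ ‖x‖) (h2 : ‖x‖ ≤ 2)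
    (h : foldForm 0 ![t, x, 1] = 0) : foldForm m ![20 * t, x, 1] ≠ 0 := by
  intro h'
  simp only [foldForm, Matrix.cons_val, Nat.cast_zero, zero_add, one_pow, mul_one] at h h'
  have ht : 1 / 5 ≤ ‖t‖ := by
    by_contra! hc
    have e : x ^ 4 = 4 * t - t ^ 4 := by linear_combination h
    have e2 : ‖x‖ ^ 4 ≤ 4 * ‖t‖ + ‖t‖ ^ 4 := by
      rw [← norm_pow, e]
      refine (norm_sub_le _ _).trans ?_
      simp
    have e3 := one_le_pow₀ h1 (n := 4)
    have e4 := pow_le_pow_left₀ (norm_nonneg t) hc.le 4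
    norm_num at e4
    linarith
  set s := 20 * t with hs
  have hs4 : 4 ≤ ‖s‖ := by rw [hs, norm_mul, Complex.norm_ofNat]; linarith
  have e : s ^ (m + 4) = (m + 4) * s - x ^ (m + 4) := by linear_combination h'
  have e2 : ‖s‖ ^ (m + 4) ≤ (m + 4) * ‖s‖ + 2 ^ (m + 4) := by
    rw [← norm_pow, e]
    refine (norm_sub_le _ _).trans ?_
    have : ‖(m + 4 : ℂ)‖ = m + 4 := by exact_mod_cast Complex.norm_natCast (m + 4)
    rw [norm_mul, norm_pow, this]
    gcongr
  have e3 : ‖s‖ * 4 ^ (m + 3) ≤ ‖s‖ ^ (m + 4) := by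
    rw [pow_succ' _ (m + 3)]
    gcongr
  have e4 : ((m : ℝ) + 4) + 2 ^ (m + 4) ≤ 4 ^ (m + 3) := by
    have h3 : ((m + 4 : ℕ) : ℝ) ≤ 2 ^ (m + 4) := by exact_mod_cast Nat.lt_two_pow_self.le
    have h4 : (1 : ℝ) ≤ 2 ^ m := one_le_pow₀ one_le_two
    have h5 : (4 : ℝ) ^ (m + 3) = 4 * 2 ^ m * 2 ^ (m + 4) := by
      rw [show (4 : ℝ) = 2 * 2 by norm_num, mul_pow]; ring
    push_cast at h3
    rw [h5]
    nlinarith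
  have e5 : (0 : ℝ) < 2 ^ (m + 4) := by positivity
  nlinarith

lemma separatesRamification_twenty (m : ℕ) : SeparatesRamification 0 m 20 :=
  separatesRamification_of_norm fun _ _ h1 h2 h => foldForm_ne_zero_of_quartic h1 h2 h

lemma separatesRamification_twenty_inv (m : ℕ) : SeparatesRamification m 0 20⁻¹ :=
  separatesRamification_of_norm fun t x h1 h2 h h' => by
    have := foldForm_ne_zero_of_quartic (m := m) h1 h2 h'
    rw [mul_inv_cancel_left₀ (by norm_num)] at this
    exact this h

section Spread

variable {ι : Type*} [Fintype ι]

lemma norm_minors_apply_le (g : ℂ → ι → ℂ) (w : ℂ) (a b : ι) :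
    ‖minors g w a b‖ ≤ ‖minors g w‖ :=
  (norm_le_pi_norm (minors g w a) b).trans (norm_le_pi_norm (minors g w) a)

open ComplexConjugate in
/-- The derivative of `‖p i‖ ^ 2 / ∑ j, ‖p j‖ ^ 2` along a curve. -/
lemma hasDerivAt_normalized_coord {p : ι → ℝ → ℂ} {p' : ι → ℂ} {t : ℝ} {i : ι}
    (hp : ∀ j, HasDerivAt (p j) (p' j) t) (h0 : ∑ j, p j t * conj (p j t) ≠ 0) :
    HasDerivAt (fun s => p i s * conj (p i s) / ∑ j, p j s * conj (p j s))
      ((conj (p i t) * ∑ j, conj (p j t) * (p' i * p j t - p i t * p' j) +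
        p i t * ∑ j, p j t * conj (p' i * p j t - p i t * p' j)) /
          (∑ j, p j t * conj (p j t)) ^ 2) t := by
  have hq : ∀ j, HasDerivAt (fun s => conj (p j s)) (conj (p' j)) t := fun j => (hp j).star
  have hpq := fun j => (hp j).fun_mul (hq j)
  have hS := HasDerivAt.fun_sum (u := Finset.univ) fun j _ => hpq j
  refine ((hpq i).fun_div hS h0).congr_deriv ?_
  congr 1
  simp only [Finset.mul_sum, ← Finset.sum_add_distrib, ← Finset.sum_sub_distrib,
    map_sub, map_mul]
  refine Finset.sum_congr rfl fun j _ => ?_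
  ring

open ComplexConjugate in
lemma norm_sum_mul_conj (x : ι → ℂ) : ‖∑ j, x j * conj (x j)‖ = ∑ j, ‖x j‖ ^ 2 := by
  have : ∑ j, x j * conj (x j) = ((∑ j, ‖x j‖ ^ 2 : ℝ) : ℂ) := by
    push_cast
    exact Finset.sum_congr rfl fun j _ => Complex.mul_conj' _
  rw [this, Complex.norm_real, Real.norm_of_nonneg (by positivity)]

lemma sq_norm_le_sum [Nonempty ι] (x : ι → ℂ) : ‖x‖ ^ 2 ≤ ∑ j, ‖x j‖ ^ 2 := by
  obtain ⟨i, hi⟩ := exists_norm_apply_eq x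
  rw [← hi]
  exact Finset.single_le_sum (f := fun j => ‖x j‖ ^ 2) (fun j _ => by positivity)
    (Finset.mem_univ i)

lemma sum_le_card_mul_sq_norm (x : ι → ℂ) : ∑ j, ‖x j‖ ^ 2 ≤ Fintype.card ι * ‖x‖ ^ 2 := by
  have : ∑ j, ‖x j‖ ^ 2 ≤ ∑ _j : ι, ‖x‖ ^ 2 :=
    Finset.sum_le_sum fun j _ => by gcongr; exact norm_le_pi_norm x j
  simpa using this

variable [Nonempty ι]

open ComplexConjugate in
/-- A curve of bounded projective speed stays, on a disc of definite size, in the standard chart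
adapted to its centre. -/
lemma sq_norm_le_of_norm_minors_le {G : ℂ → ι → ℂ} (hG : Differentiable ℂ G)
    (hG0 : ∀ w, G w ≠ 0) {w₀ : ℂ} {r : ℝ} (hr : r = 1 / (8 * (Fintype.card ι : ℝ) ^ 2))
    (hM : ∀ z ∈ ball w₀ r, ‖minors G z‖ ≤ 2 * ‖G z‖ ^ 2) {i : ι} (hi : ‖G w₀ i‖ = ‖G w₀‖)
    {z : ℂ} (hz : z ∈ ball w₀ r) : ‖G z‖ ^ 2 ≤ 2 * Fintype.card ι * ‖G z i‖ ^ 2 := by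
  set N : ℝ := (Fintype.card ι : ℝ) with hN
  have hN0 : 0 < N := by rw [hN]; exact_mod_cast Fintype.card_pos
  set e := z - w₀ with he
  have her : ‖e‖ < r := by rwa [mem_ball, dist_eq_norm] at hz
  have hmem : ∀ t ∈ Set.Icc (0 : ℝ) 1, w₀ + t * e ∈ ball w₀ r := by
    intro t ht
    rw [mem_ball, dist_eq_norm, add_sub_cancel_left, norm_mul, Complex.norm_real,
      Real.norm_of_nonneg ht.1]
    exact lt_of_le_of_lt (mul_le_of_le_one_left (norm_nonneg _) ht.2) her
  have hp : ∀ (t : ℝ) j, HasDerivAt (fun s : ℝ => G (w₀ + s * e) j)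
      (deriv G (w₀ + t * e) j * e) t := by
    intro t j
    have h1 : HasDerivAt (fun s : ℝ => w₀ + (s : ℂ) * e) e t := by
      simpa using ((Complex.ofRealCLM.hasDerivAt (x := t)).mul_const e).const_add w₀
    exact ((hasDerivAt_pi.1 (hG (w₀ + t * e)).hasDerivAt) j).comp t h1
  have hnpos : ∀ w, 0 < ‖G w‖ := fun w => norm_pos_iff.2 (hG0 w)
  have hSpos : ∀ w, 0 < ∑ j, ‖G w j‖ ^ 2 := fun w =>
    lt_of_lt_of_le (pow_pos (hnpos w) 2) (sq_norm_le_sum _)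
  have hS0 : ∀ w, ∑ j, G w j * conj (G w j) ≠ 0 := fun w => by
    rw [← norm_ne_zero_iff, norm_sum_mul_conj]; exact (hSpos w).ne'
  have key := norm_image_sub_le_of_norm_deriv_le_segment_01' (C := 4 * N * ‖e‖)
    (fun t _ => (hasDerivAt_normalized_coord (i := i) (hp t) (hS0 _)).hasDerivWithinAt) (by
      intro t ht
      have hx := hM _ (hmem t ⟨ht.1, ht.2.le⟩)
      set x := w₀ + (t : ℂ) * e
      have hd : ∀ j, deriv G x i * e * G x j - G x i * (deriv G x j * e) =
          minors G x j i * e := fun j => by simp only [minors]; ring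
      simp only [hd]
      rw [norm_div, norm_pow, norm_sum_mul_conj, div_le_iff₀ (pow_pos (hSpos x) 2)]
      have hb : ∀ j, ‖minors G x j i * e‖ ≤ 2 * ‖G x‖ ^ 2 * ‖e‖ := fun j => by
        rw [norm_mul]
        gcongr
        exact (norm_minors_apply_le G x j i).trans hx
      have hb1 : ‖∑ j, conj (G x j) * (minors G x j i * e)‖
          ≤ N * (‖G x‖ * (2 * ‖G x‖ ^ 2 * ‖e‖)) := by
        refine (norm_sum_le_of_le (f := fun j => conj (G x j) * (minors G x j i * e)) Finset.univ
          (n := fun _ => ‖G x‖ * (2 * ‖G x‖ ^ 2 * ‖e‖)) fun j _ => ?_).trans (by simp [hN])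
        rw [norm_mul, RCLike.norm_conj]
        gcongr
        · exact norm_le_pi_norm _ _
        · exact hb j
      have hb2 : ‖∑ j, G x j * conj (minors G x j i * e)‖
          ≤ N * (‖G x‖ * (2 * ‖G x‖ ^ 2 * ‖e‖)) := by
        refine (norm_sum_le_of_le (f := fun j => G x j * conj (minors G x j i * e)) Finset.univ
          (n := fun _ => ‖G x‖ * (2 * ‖G x‖ ^ 2 * ‖e‖)) fun j _ => ?_).trans (by simp [hN])
        rw [norm_mul, RCLike.norm_conj]
        gcongr
        · exact norm_le_pi_norm _ _
        · exact hb j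
      have h1 := norm_le_pi_norm (G x) i
      calc _ ≤ ‖G x‖ * (N * (‖G x‖ * (2 * ‖G x‖ ^ 2 * ‖e‖))) +
            ‖G x‖ * (N * (‖G x‖ * (2 * ‖G x‖ ^ 2 * ‖e‖))) := by
            refine (norm_add_le _ _).trans ?_
            rw [norm_mul, norm_mul, RCLike.norm_conj]
            gcongr
        _ = 4 * N * ‖e‖ * (‖G x‖ ^ 2) ^ 2 := by ring
        _ ≤ _ := by gcongr; exact sq_norm_le_sum _)
  simp only [Complex.ofReal_one, Complex.ofReal_zero, one_mul, zero_mul, add_zero,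
    show w₀ + e = z by rw [he]; ring] at key
  have hval : ∀ w, ‖G w i * conj (G w i) / ∑ j, G w j * conj (G w j)‖ =
      ‖G w i‖ ^ 2 / ∑ j, ‖G w j‖ ^ 2 := fun w => by
    rw [norm_div, norm_sum_mul_conj, norm_mul, RCLike.norm_conj, sq]
  have h0 : 1 / N ≤ ‖G w₀ i‖ ^ 2 / ∑ j, ‖G w₀ j‖ ^ 2 := by
    rw [hi, div_le_div_iff₀ hN0 (hSpos _), one_mul, mul_comm]
    exact sum_le_card_mul_sq_norm _
  have h1 : ‖G z i‖ ^ 2 / ∑ j, ‖G z j‖ ^ 2 ≤ ‖G z i‖ ^ 2 / ‖G z‖ ^ 2 := by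
    gcongr
    · exact pow_pos (hnpos z) 2
    · exact sq_norm_le_sum _
  rw [← hval] at h0 h1
  have h2 := norm_sub_norm_le (G w₀ i * conj (G w₀ i) / ∑ j, G w₀ j * conj (G w₀ j))
    (G z i * conj (G z i) / ∑ j, G z j * conj (G z j))
  rw [norm_sub_rev] at h2
  have h3 : 4 * N * ‖e‖ ≤ 1 / (2 * N) := by
    have : 4 * N * ‖e‖ ≤ 4 * N * r := by gcongr
    refine this.trans (le_of_eq ?_)
    rw [hr]; field_simp; norm_num
  have h4 : 1 / (2 * N) ≤ ‖G z i‖ ^ 2 / ‖G z‖ ^ 2 := by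
    have : 1 / N = 1 / (2 * N) + 1 / (2 * N) := by field_simp; norm_num
    linarith
  rw [div_le_div_iff₀ (by positivity) (pow_pos (hnpos z) 2)] at h4
  linarith

end Spread

section LocallyUniformLimit

variable {α : Type*} {l : Filter α} {E E' : Type*} [NormedAddCommGroup E] [NormedAddCommGroup E']

lemma TendstoLocallyUniformlyOn.continuous_comp {F : α → ℂ → E} {f : ℂ → E} {s : Set ℂ}
    (h : TendstoLocallyUniformlyOn F f l s) (hf : ContinuousOn f s) {Φ : E → E'}
    (hΦ : Continuous Φ) :
    TendstoLocallyUniformlyOn (fun k z => Φ (F k z)) (fun z => Φ (f z)) l s := by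
  rw [tendstoLocallyUniformlyOn_iff_forall_tendsto] at *
  intro x hx
  have h1 : Tendsto (fun y : α × ℂ => f y.2) (l ×ˢ 𝓝[s] x) (𝓝 (f x)) :=
    (hf x hx).tendsto.comp tendsto_snd
  have h2 : Tendsto (fun y : α × ℂ => F y.1 y.2) (l ×ˢ 𝓝[s] x) (𝓝 (f x)) :=
    h1.congr_uniformity (h x hx)
  have hΦx := (hΦ.tendsto (f x))
  exact ((hΦx.comp h1).prodMk_nhds (hΦx.comp h2)).mono_right (nhds_le_uniformity _)

variable [NormedSpace ℂ E]

/-- Montel's theorem along an ultrafilter. -/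
lemma exists_tendstoLocallyUniformlyOn_of_bounded [ProperSpace E] {U : Ultrafilter α}
    {F : α → ℂ → E} {c : ℂ} {R M : ℝ} (hR : 0 < R)
    (hd : ∀ᶠ k in (U : Filter α), DifferentiableOn ℂ (F k) (ball c R))
    (hM : ∀ᶠ k in (U : Filter α), ∀ z ∈ ball c R, ‖F k z‖ ≤ M) :
    ∃ f, TendstoLocallyUniformlyOn F f (U : Filter α) (ball c (R / 2)) := by
  set L : ℝ := M / (R / 4) with hL
  have hlip : ∀ᶠ k in (U : Filter α), ∀ x ∈ ball c (R / 2), ∀ y ∈ ball c (R / 2),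
      ‖F k y - F k x‖ ≤ L * ‖y - x‖ := by
    filter_upwards [hd, hM] with k hd hM x hx y hy
    have hsub : ∀ z ∈ ball c (R / 2), closedBall z (R / 4) ⊆ ball c R := fun z hz =>
      closedBall_subset_ball' (by rw [mem_ball] at hz; linarith)
    refine (convex_ball c (R / 2)).norm_image_sub_le_of_norm_deriv_le (𝕜 := ℂ) (fun z hz => ?_)
      (fun z hz => ?_) hx hy
    · exact hd.differentiableAt
        (isOpen_ball.mem_nhds (hsub z hz (mem_closedBall_self (by positivity))))
    · refine Complex.norm_deriv_le_of_forall_mem_sphere_norm_le (by positivity) ?_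
        fun y hy => hM y (hsub z hz (sphere_subset_closedBall hy))
      refine (hd.mono ?_).diffContOnCl
      exact closure_ball_subset_closedBall.trans (hsub z hz)
  have hex : ∀ z, ∃ y, z ∈ ball c (R / 2) → Tendsto (fun k => F k z) U (𝓝 y) := by
    intro z
    by_cases hz : z ∈ ball c (R / 2)
    · obtain ⟨y, -, hy⟩ := (isCompact_closedBall (0 : E) M).ultrafilter_le_nhds
        (U.map fun k => F k z) (by
          rw [le_principal_iff, Ultrafilter.coe_map, mem_map]
          filter_upwards [hM] with k hk
          simpa using hk z (ball_subset_ball (by linarith) hz))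
      exact ⟨y, fun _ => hy⟩
    · exact ⟨0, fun h => absurd h hz⟩
  choose f hf using hex
  have hflip : ∀ x ∈ ball c (R / 2), ∀ y ∈ ball c (R / 2), ‖f y - f x‖ ≤ L * ‖y - x‖ := by
    intro x hx y hy
    refine le_of_tendsto ((hf y hy).sub (hf x hx)).norm ?_
    filter_upwards [hlip] with k hk using hk x hx y hy
  refine ⟨f, Metric.tendstoLocallyUniformlyOn_iff.2 fun ε hε x hx => ?_⟩
  have hδ : 0 < ε / (3 * (|L| + 1)) := by positivity
  refine ⟨ball x (ε / (3 * (|L| + 1))) ∩ ball c (R / 2),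
    inter_mem (mem_nhdsWithin_of_mem_nhds (ball_mem_nhds x hδ)) self_mem_nhdsWithin, ?_⟩
  filter_upwards [hlip, Metric.tendsto_nhds.1 (hf x hx) (ε / 3) (by positivity)] with k hk hkx y hy
  have hyx : L * ‖y - x‖ ≤ ε / 3 := by
    have h1 : ‖y - x‖ ≤ ε / (3 * (|L| + 1)) := by
      have := hy.1
      rw [mem_ball, dist_eq_norm] at this
      exact this.le
    calc L * ‖y - x‖ ≤ (|L| + 1) * ‖y - x‖ := by
          gcongr; linarith [le_abs_self L]
      _ ≤ (|L| + 1) * (ε / (3 * (|L| + 1))) := by gcongr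
      _ = ε / 3 := by field_simp
  have h1 := hflip x hx y hy.2
  have h2 := hk x hx y hy.2
  rw [← dist_eq_norm] at h1 h2
  calc dist (f y) (F k y) ≤ dist (f y) (f x) + dist (f x) (F k x) + dist (F k x) (F k y) :=
        dist_triangle4 _ _ _ _
    _ < ε := by
        rw [dist_comm (f x), dist_comm (F k x) (F k y)]; linarith

/-- Hurwitz's theorem: a locally uniform limit of holomorphic functions without zeros which vanishes
at a point vanishes identically near this point. -/
lemma eventually_eq_zero_of_tendstoLocallyUniformlyOn [l.NeBot] {F : α → ℂ → ℂ} {φ : ℂ → ℂ}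
    {w₀ : ℂ} {r : ℝ} (hr : 0 < r) (hF : ∀ᶠ k in l, DifferentiableOn ℂ (F k) (ball w₀ r))
    (hne : ∀ᶠ k in l, ∀ z ∈ ball w₀ r, F k z ≠ 0)
    (hlim : TendstoLocallyUniformlyOn F φ l (ball w₀ r)) (h0 : φ w₀ = 0) :
    ∀ᶠ w in 𝓝 w₀, φ w = 0 := by
  have hφ := hlim.differentiableOn hF isOpen_ball
  have han : AnalyticAt ℂ φ w₀ := hφ.analyticAt (ball_mem_nhds w₀ hr)
  refine han.eventually_eq_zero_or_eventually_ne_zero.resolve_right fun h1 => ?_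
  rw [eventually_nhdsWithin_iff] at h1
  obtain ⟨δ, hδ, H⟩ := Metric.eventually_nhds_iff_ball.1 h1
  set ρ := min δ r / 2 with hρ
  have hρ0 : 0 < ρ := by positivity
  have hρδ : ρ < δ := by have := min_le_left δ r; have := lt_min hδ hr; linarith
  have hρr : ρ < r := by have := min_le_right δ r; have := lt_min hδ hr; linarith
  have hsub : closedBall w₀ ρ ⊆ ball w₀ r := closedBall_subset_ball hρr
  obtain ⟨y, hy, hmin⟩ := (isCompact_sphere w₀ ρ).exists_isMinOn
    (NormedSpace.sphere_nonempty.2 hρ0.le)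
    ((hφ.continuousOn.mono (sphere_subset_closedBall.trans hsub)).norm)
  set μ := ‖φ y‖ with hμ
  have hμ0 : 0 < μ := by
    refine norm_pos_iff.2 (H y (sphere_subset_closedBall.trans (closedBall_subset_ball hρδ) hy) ?_)
    rintro rfl
    simp [hρ0.ne] at hy
  have hunif := (tendstoLocallyUniformlyOn_iff_forall_isCompact isOpen_ball).1 hlim
    (closedBall w₀ ρ) hsub (isCompact_closedBall w₀ ρ)
  obtain ⟨k, hk, hkd, hkn⟩ := ((Metric.tendstoUniformlyOn_iff.1 hunif (μ / 2)
    (by positivity)).and (hF.and hne)).exists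
  have hmax := Complex.norm_le_of_forall_mem_frontier_norm_le (U := ball w₀ ρ)
    (f := fun z => (F k z)⁻¹) (C := 2 / μ) isBounded_ball (by
      refine DifferentiableOn.diffContOnCl ?_
      exact ((hkd.inv hkn).mono hsub).mono closure_ball_subset_closedBall) (by
      intro z hz
      rw [frontier_ball w₀ hρ0.ne'] at hz
      have h2 : μ ≤ ‖φ z‖ := hmin hz
      have h3 := hk z (sphere_subset_closedBall hz)
      rw [dist_eq_norm] at h3
      have h4 := norm_sub_norm_le (φ z) (F k z)
      rw [norm_inv, inv_eq_one_div, div_le_div_iff₀ (by linarith) hμ0]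
      linarith) (z := w₀) (subset_closure (mem_ball_self hρ0))
  have h5 := hk w₀ (mem_closedBall_self hρ0.le)
  rw [h0, dist_eq_norm, zero_sub, norm_neg] at h5
  have h6 : 0 < ‖F k w₀‖ := norm_pos_iff.2 (hkn w₀ (mem_ball_self hr))
  rw [norm_inv, inv_eq_one_div, div_le_div_iff₀ h6 hμ0] at hmax
  linarith

end LocallyUniformLimit

section BrodyLimit

variable {ι : Type*}

/-- On the disc of centre `w₀` and radius `r`, the lifts `H k` of the curves `G k` converge to
`h`. -/
structure IsLocalLimit (l : Filter ℕ) (G : ℕ → ℂ → ι → ℂ) (w₀ : ℂ) (r : ℝ)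
    (H : ℕ → ℂ → ι → ℂ) (h : ℂ → ι → ℂ) : Prop where
  pos : 0 < r
  differentiableOn : ∀ᶠ k in l, DifferentiableOn ℂ (H k) (ball w₀ r)
  eq_smul : ∀ᶠ k in l, ∃ c : ℂ → ℂ, DifferentiableOn ℂ c (ball w₀ r) ∧
    ∀ z ∈ ball w₀ r, c z ≠ 0 ∧ H k z = c z • G k z
  tendsto : TendstoLocallyUniformlyOn H h l (ball w₀ r)
  ne_zero : ∀ z ∈ ball w₀ r, h z ≠ 0

namespace IsLocalLimit

variable {l : Filter ℕ} {G H K : ℕ → ℂ → ι → ℂ} {h k : ℂ → ι → ℂ} {w₀ w₁ : ℂ} {r s : ℝ}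

lemma mono (hh : IsLocalLimit l G w₀ r H h) (hs : 0 < s) (hsr : s ≤ r) :
    IsLocalLimit l G w₀ s H h where
  pos := hs
  differentiableOn := hh.differentiableOn.mono fun _ h => h.mono (ball_subset_ball hsr)
  eq_smul := hh.eq_smul.mono fun _ ⟨c, h1, h2⟩ => ⟨c, h1.mono (ball_subset_ball hsr), fun z hz =>
    h2 z (ball_subset_ball hsr hz)⟩
  tendsto := hh.tendsto.mono (ball_subset_ball hsr)
  ne_zero z hz := hh.ne_zero z (ball_subset_ball hsr hz)

lemma tendsto_at (hh : IsLocalLimit l G w₀ r H h) {z : ℂ} (hz : z ∈ ball w₀ r) :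
    Tendsto (fun k => H k z) l (𝓝 (h z)) :=
  hh.tendsto.tendsto_at hz

lemma exists_smul (hh : IsLocalLimit l G w₀ r H h) :
    ∀ᶠ k in l, ∀ z ∈ ball w₀ r, ∃ c : ℂ, c ≠ 0 ∧ H k z = c • G k z := by
  filter_upwards [hh.eq_smul] with n ⟨c, _, hc⟩ z hz using ⟨c z, hc z hz⟩

variable [l.NeBot]

lemma proportional (hh : IsLocalLimit l G w₀ r H h) (hk : IsLocalLimit l G w₁ s K k) {z : ℂ}
    (hz : z ∈ ball w₀ r) (hz' : z ∈ ball w₁ s) : Proportional (h z) (k z) := by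
  intro a b
  have h1 := fun a => (tendsto_pi_nhds.1 (hh.tendsto_at hz)) a
  have h2 := fun a => (tendsto_pi_nhds.1 (hk.tendsto_at hz')) a
  refine tendsto_nhds_unique (((h1 a).mul (h2 b)).congr' ?_) ((h1 b).mul (h2 a))
  filter_upwards [hh.eq_smul, hk.eq_smul] with n ⟨c, _, hc⟩ ⟨d, _, hd⟩
  simp only [(hc z hz).2, (hd z hz').2, Pi.smul_apply, smul_eq_mul]
  ring

variable [Fintype ι]

lemma differentiableOn_limit (hh : IsLocalLimit l G w₀ r H h) :
    DifferentiableOn ℂ h (ball w₀ r) :=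
  hh.tendsto.differentiableOn hh.differentiableOn isOpen_ball

lemma tendsto_comp (hh : IsLocalLimit l G w₀ r H h) {Φ : (ι → ℂ) → ℂ} (hΦ : Continuous Φ) :
    TendstoLocallyUniformlyOn (fun k z => Φ (H k z)) (fun z => Φ (h z)) l (ball w₀ r) :=
  hh.tendsto.continuous_comp hh.differentiableOn_limit.continuousOn hΦ

lemma norm_minors_eq (hh : IsLocalLimit l G w₀ r H h)
    (hG : ∀ k, Differentiable ℂ (G k)) (hn : ∀ k, ‖minors (G k) w₀‖ = ‖G k w₀‖ ^ 2) :
    ‖minors h w₀‖ = ‖h w₀‖ ^ 2 := by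
  have hw : w₀ ∈ ball w₀ r := mem_ball_self hh.pos
  have h1 := hh.tendsto_at hw
  have h2 := (hh.tendsto.deriv hh.differentiableOn isOpen_ball).tendsto_at hw
  simp only [Function.comp_apply] at h2
  have h3 : Tendsto (fun k => minors (H k) w₀) l (𝓝 (minors h w₀)) := by
    rw [tendsto_pi_nhds] at h1 h2
    refine tendsto_pi_nhds.2 fun a => tendsto_pi_nhds.2 fun b => ?_
    exact ((h1 a).mul (h2 b)).sub ((h1 b).mul (h2 a))
  refine tendsto_nhds_unique (h3.norm.congr' ?_) (h1.norm.pow 2)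
  filter_upwards [hh.eq_smul] with n ⟨c, hc, hcG⟩
  have hU := ball_mem_nhds w₀ hh.pos
  rw [minors_eq_of_eventually_eq_smul (hc.differentiableAt hU) (hG n w₀)
    (by filter_upwards [hU] with z hz using (hcG z hz).2), (hcG w₀ hw).2, norm_smul, norm_smul,
    hn, norm_pow, mul_pow]

end IsLocalLimit

variable [Fintype ι]

lemma exists_isLocalLimit [Nonempty ι] {U : Ultrafilter ℕ} (hU : (U : Filter ℕ) ≤ atTop)
    {G : ℕ → ℂ → ι → ℂ} (hG : ∀ k, Differentiable ℂ (G k)) (hG0 : ∀ k w, G k w ≠ 0)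
    (hM : ∀ (k : ℕ) z, ‖z‖ ≤ k → ‖minors (G k) z‖ ≤ 2 * ‖G k z‖ ^ 2) (w₀ : ℂ) :
    ∃ r H h, IsLocalLimit U G w₀ r H h := by
  set N : ℝ := (Fintype.card ι : ℝ) with hN
  have hN1 : 1 ≤ N := by rw [hN]; exact_mod_cast Fintype.card_pos
  set r : ℝ := 1 / (8 * N ^ 2) with hr
  have hr0 : 0 < r := by positivity
  have hr1 : r ≤ 1 := by
    rw [hr, div_le_one (by positivity)]; nlinarith
  choose i hi using fun k => exists_norm_apply_eq (G k w₀)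
  have hb : ∀ᶠ k in (U : Filter ℕ), ∀ z ∈ ball w₀ r, ‖G k z‖ ^ 2 ≤ 2 * N * ‖G k z (i k)‖ ^ 2 := by
    obtain ⟨n, hn⟩ := exists_nat_ge (‖w₀‖ + 1)
    filter_upwards [hU (eventually_ge_atTop n)] with k hk z hz
    refine sq_norm_le_of_norm_minors_le (hG k) (hG0 k) hr (fun z hz => hM k z ?_) (hi k) hz
    have h1 : ‖z - w₀‖ < r := by rwa [mem_ball, dist_eq_norm] at hz
    have h2 : ‖z‖ ≤ ‖z - w₀‖ + ‖w₀‖ := by simpa using norm_add_le (z - w₀) w₀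
    have h3 : (n : ℝ) ≤ k := by exact_mod_cast hk
    linarith
  have hne : ∀ᶠ k in (U : Filter ℕ), ∀ z ∈ ball w₀ r, G k z (i k) ≠ 0 := by
    filter_upwards [hb] with k hk z hz h0
    have := hk z hz
    rw [h0, norm_zero] at this
    have h1 : 0 < ‖G k z‖ ^ 2 := pow_pos (norm_pos_iff.2 (hG0 k z)) 2
    linarith
  have hc : ∀ᶠ k in (U : Filter ℕ), DifferentiableOn ℂ (fun z => (G k z (i k))⁻¹) (ball w₀ r) := by
    filter_upwards [hne] with k hk
    exact (differentiable_pi.1 (hG k) (i k)).differentiableOn.inv hk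
  set H : ℕ → ℂ → ι → ℂ := fun k z => (G k z (i k))⁻¹ • G k z with hH
  have hd : ∀ᶠ k in (U : Filter ℕ), DifferentiableOn ℂ (H k) (ball w₀ r) := by
    filter_upwards [hc] with k hk using hk.smul (hG k).differentiableOn
  have hbd : ∀ᶠ k in (U : Filter ℕ), ∀ z ∈ ball w₀ r, ‖H k z‖ ≤ √(2 * N) := by
    filter_upwards [hb, hne] with k hk hk' z hz
    have h1 : 0 < ‖G k z (i k)‖ := norm_pos_iff.2 (hk' z hz)
    refine Real.le_sqrt_of_sq_le ?_
    simp only [hH]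
    rw [norm_smul, norm_inv, mul_pow, inv_pow, inv_mul_le_iff₀ (by positivity), mul_comm]
    exact hk z hz
  obtain ⟨h, hh⟩ := exists_tendstoLocallyUniformlyOn_of_bounded hr0 hd hbd
  have hlt : r / 2 ≤ r := by linarith
  have hsub := ball_subset_ball (x := w₀) hlt
  refine ⟨r / 2, H, h, by positivity, hd.mono fun _ h => h.mono hsub, ?_, hh, fun z hz h0 => ?_⟩
  · filter_upwards [hc, hne] with k hk hk'
    exact ⟨_, hk.mono hsub, fun z hz => ⟨inv_ne_zero (hk' z (hsub hz)), rfl⟩⟩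
  · have h1 := (hh.tendsto_at hz).norm
    have h2 : 1 ≤ ‖h z‖ := by
      refine ge_of_tendsto h1 ?_
      filter_upwards [hne] with k hk
      have := norm_le_pi_norm (H k z) (i k)
      simpa [hH, hk z (hsub hz)] using this
    rw [h0, norm_zero] at h2
    linarith

/-- Brody's reparametrisation: nonconstant entire curves can be rescaled so as to be normalised at
the origin with bounded projective speed on large discs. -/
lemma exists_rescaling {g : ℂ → ι → ℂ} (hg : Differentiable ℂ g) (hg0 : ∀ w, g w ≠ 0)
    (hnc : ∃ w w', ¬ Proportional (g w) (g w')) {R : ℝ} (hR : 0 < R) :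
    ∃ a b : ℂ, ‖minors (fun z => g (a + b * z)) 0‖ = ‖g a‖ ^ 2 ∧ ∀ z, ‖z‖ ≤ R →
      ‖minors (fun z => g (a + b * z)) z‖ ≤ 2 * ‖g (a + b * z)‖ ^ 2 := by
  have hpos : ∀ w, 0 < ‖g w‖ ^ 2 := fun w => pow_pos (norm_pos_iff.2 (hg0 w)) 2
  obtain ⟨w₁, hw₁⟩ : ∃ w, minors g w ≠ 0 := by
    by_contra! hc
    obtain ⟨w, w', hw⟩ := hnc
    refine hw ((IsProjHol.of_differentiable hg hg0).proportional_of_minors_eq_zero (w₀ := 0)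
      ⟨hg.analyticAt 0, hg0 0, Eventually.of_forall fun z => ⟨hg0 z, fun a b => by ring⟩⟩
      (Eventually.of_forall hc) w w')
  have hdc : Continuous (deriv g) := (hg.contDiff (n := 1)).continuous_deriv le_rfl
  have hcont : Continuous (minors g) := by
    refine continuous_pi fun a => continuous_pi fun b => ?_
    have h1 := fun a => (continuous_apply a).comp hg.continuous
    have h2 := fun a => (continuous_apply a).comp hdc
    exact ((h1 a).mul (h2 b)).sub ((h1 b).mul (h2 a))
  obtain ⟨a, ha, hb⟩ := exists_rescaling_center (D := fun w => ‖minors g w‖ / ‖g w‖ ^ 2)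
    (hcont.norm.div (hg.continuous.norm.pow 2) fun w => (hpos w).ne') (w₀ := w₁)
    (div_pos (norm_pos_iff.2 hw₁) (hpos w₁)) hR
  set δ : ℝ := ‖minors g a‖ / ‖g a‖ ^ 2 with hδ
  have hm : ∀ z, ‖minors (fun z => g (a + (δ : ℂ)⁻¹ * z)) z‖ =
      ‖minors g (a + (δ : ℂ)⁻¹ * z)‖ / δ := by
    intro z
    have h1 : deriv (fun z => g (a + (δ : ℂ)⁻¹ * z)) z =
        (δ : ℂ)⁻¹ • deriv g (a + (δ : ℂ)⁻¹ * z) := by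
      have h2 : HasDerivAt (fun z => a + (δ : ℂ)⁻¹ * z) ((δ : ℂ)⁻¹) z := by
        simpa using ((hasDerivAt_id z).const_mul ((δ : ℂ)⁻¹)).const_add a
      exact ((hg _).hasDerivAt.scomp z h2).deriv
    have h3 : minors (fun z => g (a + (δ : ℂ)⁻¹ * z)) z =
        (δ : ℂ)⁻¹ • minors g (a + (δ : ℂ)⁻¹ * z) := by
      ext i j
      simp only [minors, h1, Pi.smul_apply, smul_eq_mul]
      ring
    rw [h3, norm_smul, norm_inv, Complex.norm_real, Real.norm_of_nonneg ha.le, inv_mul_eq_div]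
  refine ⟨a, (δ : ℂ)⁻¹, ?_, fun z hz => ?_⟩
  · rw [hm, mul_zero, add_zero, div_eq_iff ha.ne', hδ, mul_div_cancel₀ _ (hpos a).ne']
  · have h1 := hb (a + (δ : ℂ)⁻¹ * z) (by
      rw [add_sub_cancel_left, norm_mul, norm_inv, Complex.norm_real, Real.norm_of_nonneg ha.le]
      field_simp
      exact hz)
    rw [div_le_iff₀ (hpos _)] at h1
    rw [hm, div_le_iff₀ ha]
    linarith

/-- Brody's lemma for sequences of entire curves in projective space. -/
theorem exists_brody_limit [Nonempty ι] {g : ℕ → ℂ → ι → ℂ} (hg : ∀ k, Differentiable ℂ (g k))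
    (hg0 : ∀ k w, g k w ≠ 0) (hnc : ∀ k, ∃ w w', ¬ Proportional (g k w) (g k w')) :
    ∃ (U : Ultrafilter ℕ) (G : ℕ → ℂ → ι → ℂ) (f : ℂ → ι → ℂ), (U : Filter ℕ) ≤ atTop ∧
      (∀ k z, ∃ w, G k z = g k w) ∧ IsProjHol f ∧ (∃ w w', ¬ Proportional (f w) (f w')) ∧
      ∀ w₀, ∃ r H h, IsLocalLimit U G w₀ r H h ∧ IsLiftAt f h w₀ := by
  have hk1 : ∀ k : ℕ, (0 : ℝ) < k + 1 := fun k => by positivity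
  choose a b h0 hM using fun k => exists_rescaling (hg k) (hg0 k) (hnc k) (hk1 k)
  set G : ℕ → ℂ → ι → ℂ := fun k z => g k (a k + b k * z) with hG
  have hGd : ∀ k, Differentiable ℂ (G k) := fun k =>
    (hg k).comp ((differentiable_id.const_mul (b k)).const_add (a k))
  have hU : (hyperfilter ℕ : Filter ℕ) ≤ atTop := by
    rw [← Nat.cofinite_eq_atTop]; exact hyperfilter_le_cofinite
  choose r H h hh using exists_isLocalLimit hU hGd (fun k w => hg0 k _)
    (fun k z hz => hM k z (by linarith))
  have hlift : ∀ w₀, IsLiftAt (fun w => h w w) (h w₀) w₀ := by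
    intro w₀
    have hb := ball_mem_nhds w₀ (hh w₀).pos
    refine ⟨(hh w₀).differentiableOn_limit.analyticAt hb,
      (hh w₀).ne_zero w₀ (mem_ball_self (hh w₀).pos), ?_⟩
    filter_upwards [hb] with w hw
    have hw' := mem_ball_self (x := w) (hh w).pos
    exact ⟨(hh w).ne_zero w hw', (hh w).proportional (hh w₀) hw' hw⟩
  refine ⟨hyperfilter ℕ, G, fun w => h w w, hU, fun k z => ⟨_, rfl⟩, fun w₀ => ⟨_, hlift w₀⟩, ?_,
    fun w₀ => ⟨_, _, _, hh w₀, hlift w₀⟩⟩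
  by_contra! hc
  have hne := (hlift 0).ne_zero
  have hn := (hh 0).norm_minors_eq hGd (fun k => by simpa [hG] using h0 k)
  have hz : minors (h 0) 0 = 0 := by
    have hd := hasDerivAt_pi.1 (hlift 0).analyticAt.differentiableAt.hasDerivAt
    ext i j
    have h1 : (fun w => h 0 w i * h 0 0 j) =ᶠ[𝓝 0] fun w => h 0 w j * h 0 0 i := by
      filter_upwards [(hlift 0).eventually] with w hw
      exact hw.2.symm.trans (hc w 0) hw.1 i j
    have h2 := h1.deriv_eq
    rw [((hd i).mul_const _).deriv, ((hd j).mul_const _).deriv] at h2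
    simp only [minors, Pi.zero_apply]
    linear_combination -h2
  rw [hz, norm_zero] at hn
  exact hne (norm_eq_zero.1 (pow_eq_zero_iff two_ne_zero |>.1 hn.symm))

end BrodyLimit

section Deformation

variable {ι : Type*} [Fintype ι] {U : Ultrafilter ℕ} {G : ℕ → ℂ → ι → ℂ} {f : ℂ → ι → ℂ}

lemma eq_zero_of_isLocalLimit
    (hloc : ∀ w₀, ∃ r H h, IsLocalLimit U G w₀ r H h ∧ IsLiftAt f h w₀) {d : ℕ}
    {Ψ L : (ι → ℂ) → ℂ} (hΨc : Continuous Ψ) (hLc : Continuous L)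
    (hΨ : ∀ c x, Ψ (c • x) = c ^ d * Ψ x) (hL : ∀ c x, L (c • x) = c ^ d * L x) {ε : ℕ → ℂ}
    (hε : Tendsto ε U (𝓝 0)) (h : ∀ k z, Ψ (G k z) + ε k * L (G k z) = 0) (w : ℂ) :
    Ψ (f w) = 0 := by
  obtain ⟨r, H, h', hH, hf⟩ := hloc w
  have hw := mem_ball_self (x := w) hH.pos
  have h1 := hH.tendsto_at hw
  have h2 := ((hΨc.tendsto _).comp h1).add (hε.mul ((hLc.tendsto _).comp h1))
  have h3 : Ψ (h' w) + 0 * L (h' w) = 0 := by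
    refine tendsto_nhds_unique h2 (tendsto_const_nhds.congr' ?_)
    filter_upwards [hH.exists_smul] with k hk
    obtain ⟨c, -, hc⟩ := hk w hw
    simp only [Function.comp_apply, hc, hΨ, hL]
    linear_combination -c ^ d * h k w
  obtain ⟨c, -, hc⟩ := hf.exists_smul
  rw [hc, hΨ, show Ψ (h' w) = 0 by simpa using h3, mul_zero]

lemma forall_eq_zero_or_of_isLocalLimit
    (hloc : ∀ w₀, ∃ r H h, IsLocalLimit U G w₀ r H h ∧ IsLiftAt f h w₀)
    {B L : (ι → ℂ) → ℂ} (hBd : Differentiable ℂ B) (hLc : Continuous L)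
    (hB : ∀ c : ℂ, c ≠ 0 → ∀ x, B (c • x) = 0 ↔ B x = 0)
    (hL : ∀ c : ℂ, c ≠ 0 → ∀ x, L (c • x) = 0 ↔ L x = 0)
    (h : ∀ k z, B (G k z) = 0 → L (G k z) = 0) :
    (∀ w, B (f w) = 0) ∨ ∀ w, B (f w) = 0 → L (f w) = 0 := by
  have hf : IsProjHol f := fun w₀ => by
    obtain ⟨_, _, h, -, hh⟩ := hloc w₀
    exact ⟨h, hh⟩
  by_contra! hc
  obtain ⟨⟨w₁, hw₁⟩, w₀, hB0, hL0⟩ := hc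
  obtain ⟨r, H, h', hH, hl⟩ := hloc w₀
  refine hw₁ (hf.forall_eq_zero hBd hB (w₀ := w₀) ?_ w₁)
  have hw := mem_ball_self (x := w₀) hH.pos
  have hL0' : L (h' w₀) ≠ 0 := fun h0 => hL0 ((hl.eventually_zero_iff hL).self_of_nhds.2 h0)
  have hB0' : B (h' w₀) = 0 := (hl.eventually_zero_iff hB).self_of_nhds.1 hB0
  obtain ⟨s, hs, hsr, hne⟩ : ∃ s, 0 < s ∧ s ≤ r ∧
      ∀ᶠ k in (U : Filter ℕ), ∀ z ∈ ball w₀ s, L (H k z) ≠ 0 := by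
    have h1 := (isOpen_ball.tendstoLocallyUniformlyOn_iff_forall_tendsto).1 (hH.tendsto_comp hLc)
      w₀ hw
    have h2 : Tendsto (fun y : ℕ × ℂ => L (h' y.2)) ((U : Filter ℕ) ×ˢ 𝓝 w₀) (𝓝 (L (h' w₀))) :=
      (hLc.continuousAt.comp hl.analyticAt.continuousAt).tendsto.comp tendsto_snd
    obtain ⟨p, hp, q, hq, hpq⟩ := eventually_prod_iff.1
      ((h2.congr_uniformity h1).eventually_ne hL0')
    obtain ⟨δ, hδ, hqδ⟩ := Metric.eventually_nhds_iff_ball.1 hq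
    refine ⟨min δ r, lt_min hδ hH.pos, min_le_right _ _, ?_⟩
    filter_upwards [hp] with k hk z hz
    exact hpq hk (hqδ z (ball_subset_ball (min_le_left _ _) hz))
  have hH' := hH.mono hs hsr
  have h1 := eventually_eq_zero_of_tendstoLocallyUniformlyOn hs
    (F := fun k z => B (H k z)) (φ := fun z => B (h' z))
    (hH'.differentiableOn.mono fun k hk => hBd.comp_differentiableOn hk) (by
      filter_upwards [hne, hH'.exists_smul] with k hk hk' z hz hz0
      obtain ⟨c, hc, e⟩ := hk' z hz
      rw [e, hB c hc] at hz0
      exact hk z hz (by rw [e, hL c hc]; exact h k z hz0))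
    (hH'.tendsto_comp hBd.continuous) hB0'
  filter_upwards [h1, hl.eventually_zero_iff hB] with w h2 h3 using h3.2 h2

end Deformation

section Surface

/-- The cone over a plane curve `foldForm k = 0`, with vertex a coordinate point. -/
noncomputable def conePolynomial (k : ℕ) (i : Fin 4) : MvPolynomial (Fin 4) ℂ :=
  X i ^ (k + 4) - C ((k : ℂ) + 4) * X 2 ^ (k + 3) * X i + X 1 ^ (k + 4)

lemma eval_conePolynomial (k : ℕ) (i : Fin 4) (v : Fin 4 → ℂ) :
    eval v (conePolynomial k i) = foldForm k ![v i, v 1, v 2] := by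
  simp [conePolynomial, foldForm]

lemma isHomogeneous_conePolynomial (k : ℕ) (i : Fin 4) :
    (conePolynomial k i).IsHomogeneous (k + 4) := by
  have h := fun j : Fin 4 => isHomogeneous_X ℂ j
  have hp := fun (j : Fin 4) n => isHomogeneous_X_pow (R := ℂ) j n
  refine ((hp i _).sub ?_).add (hp 1 _)
  have := ((isHomogeneous_C (Fin 4) ((k : ℂ) + 4)).mul (hp 2 (k + 3))).mul (h i)
  rwa [zero_add] at this

/-- A deformation of the union of two cones by a multiple plane. -/
noncomputable def deformedCones (m : ℕ) (ε : ℂ) : MvPolynomial (Fin 4) ℂ :=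
  conePolynomial 0 0 * conePolynomial m 3 + C ε * (X 3 - C 20 * X 0) ^ (m + 8)

lemma eval_deformedCones (m : ℕ) (ε : ℂ) (v : Fin 4 → ℂ) :
    eval v (deformedCones m ε) = foldForm 0 ![v 0, v 1, v 2] * foldForm m ![v 3, v 1, v 2] +
      ε * (v 3 - 20 * v 0) ^ (m + 8) := by
  simp [deformedCones, eval_conePolynomial]

lemma isHomogeneous_deformedCones (m : ℕ) (ε : ℂ) : (deformedCones m ε).IsHomogeneous (m + 8) := by
  have hc := (isHomogeneous_conePolynomial 0 0).mul (isHomogeneous_conePolynomial m 3)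
  have hl : (X 3 - C 20 * X 0 : MvPolynomial (Fin 4) ℂ).IsHomogeneous 1 := by
    have h := (isHomogeneous_C (Fin 4) (20 : ℂ)).mul (isHomogeneous_X ℂ (0 : Fin 4))
    rw [zero_add] at h
    exact (isHomogeneous_X ℂ 3).sub h
  have hp := (isHomogeneous_C (Fin 4) ε).mul (hl.pow (m + 8))
  rw [show 0 + 4 + (m + 4) = m + 8 by ring] at hc
  rw [zero_add, one_mul] at hp
  exact hc.add hp

lemma deformedCones_ne_zero (m : ℕ) {ε : ℂ} (hε : ε ≠ 0) : deformedCones m ε ≠ 0 := by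
  intro h
  have := eval_deformedCones m ε ![1, 0, 0, 0]
  rw [h] at this
  simp [foldForm, hε] at this

lemma foldForm_vec_smul (k : ℕ) (i : Fin 4) (c : ℂ) (x : Fin 4 → ℂ) :
    foldForm k ![(c • x) i, (c • x) 1, (c • x) 2] =
      c ^ (k + 4) * foldForm k ![x i, x 1, x 2] := by
  rw [← foldForm_smul]
  congr 1
  ext j; fin_cases j <;> rfl

lemma differentiable_foldForm_vec (k : ℕ) (i : Fin 4) :
    Differentiable ℂ fun x : Fin 4 → ℂ => foldForm k ![x i, x 1, x 2] := by
  simp only [foldForm, Matrix.cons_val_zero, Matrix.cons_val_one, Matrix.cons_val]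
  fun_prop

/-- A sufficiently small deformation of the two cones is Brody hyperbolic. -/
theorem exists_deformedCones_hyperbolic (m : ℕ) : ∃ ε : ℂ, ε ≠ 0 ∧
    ∀ g : ℂ → Fin 4 → ℂ, Differentiable ℂ g → (∀ w, g w ≠ 0) →
      (∀ w, eval (g w) (deformedCones m ε) = 0) → ∀ w w', Proportional (g w) (g w') := by
  by_contra! hcon
  have hε0 : ∀ k : ℕ, (1 / ((k : ℂ) + 1)) ≠ 0 := fun k =>
    one_div_ne_zero (Nat.cast_add_one_ne_zero k)
  choose g hg hg0 hgF hnc using fun k : ℕ => hcon _ (hε0 k)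
  obtain ⟨U, G, f, hU, hGg, hf, ⟨w, w', hw⟩, hloc⟩ := exists_brody_limit hg hg0 hnc
  have hF : ∀ k z, foldForm 0 ![G k z 0, G k z 1, G k z 2] *
      foldForm m ![G k z 3, G k z 1, G k z 2] +
        1 / ((k : ℂ) + 1) * (G k z 3 - 20 * G k z 0) ^ (m + 8) = 0 := by
    intro k z
    obtain ⟨w, e⟩ := hGg k z
    rw [e, ← eval_deformedCones]
    exact hgF k w
  have hzero : ∀ k (i : Fin 4) (c : ℂ), c ≠ 0 → ∀ x : Fin 4 → ℂ,
      foldForm k ![(c • x) i, (c • x) 1, (c • x) 2] = 0 ↔ foldForm k ![x i, x 1, x 2] = 0 := by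
    intro k i c hc x
    rw [foldForm_vec_smul]; simp [hc]
  have hd := differentiable_foldForm_vec
  have hplane : ∀ c x, ((c • x : Fin 4 → ℂ) 3 - 20 * (c • x : Fin 4 → ℂ) 0) =
      c * (x 3 - 20 * x 0) := by
    intro c x
    simp only [Pi.smul_apply, smul_eq_mul]; ring
  have hprod := eq_zero_of_isLocalLimit hloc (d := m + 8)
    (Ψ := fun x => foldForm 0 ![x 0, x 1, x 2] * foldForm m ![x 3, x 1, x 2])
    (L := fun x => (x 3 - 20 * x 0) ^ (m + 8))
    ((hd 0 0).continuous.mul (hd m 3).continuous) (by fun_prop)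
    (fun c x => by rw [foldForm_vec_smul, foldForm_vec_smul]; ring)
    (fun c x => by rw [hplane, mul_pow])
    ((tendsto_one_div_add_atTop_nhds_zero_nat (𝕜 := ℂ)).mono_left hU) hF
  have hdich : ∀ k (i : Fin 4), (∀ n z, foldForm k ![G n z i, G n z 1, G n z 2] = 0 →
      foldForm 0 ![G n z 0, G n z 1, G n z 2] * foldForm m ![G n z 3, G n z 1, G n z 2] = 0) →
      (∀ w, foldForm k ![f w i, f w 1, f w 2] = 0) ∨
        ∀ w, foldForm k ![f w i, f w 1, f w 2] = 0 → f w 3 - 20 * f w 0 = 0 := by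
    intro k i hki
    refine forall_eq_zero_or_of_isLocalLimit hloc (hd k i)
      (L := fun x => x 3 - 20 * x 0) (by fun_prop) (hzero k i)
      (fun c hc x => by rw [hplane]; simp [hc]) fun n z h0 => ?_
    have := hF n z
    rw [hki n z h0, zero_add] at this
    exact pow_eq_zero_iff (by omega) |>.1 ((mul_eq_zero.1 this).resolve_left (hε0 n))
  refine hw ?_
  rcases hf.forall_eq_zero_or (hd 0 0) (hd m 3) (hzero 0 0) (hzero m 3)
    (fun w => mul_eq_zero.1 (hprod w)) with hA | hB
  · refine hf.proportional_of_cone (separatesRamification_twenty m) hA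
      ((hdich m 3 fun n z h => by rw [h, mul_zero]).imp_right fun h w h0 => ?_) w w'
    linear_combination h w h0
  · let σ : Fin 4 → Fin 4 := ![3, 1, 2, 0]
    have hσ : ∀ i, σ (σ i) = i := by decide
    have hfσ : IsProjHol fun w => f w ∘ σ := hf.comp_of_ne_zero σ fun w h0 =>
      hf.ne_zero w (funext fun i => by simpa [hσ] using congrFun h0 (σ i))
    have h1 := hfσ.proportional_of_cone (separatesRamification_twenty_inv m) hB
      ((hdich 0 0 fun n z h => by rw [h, zero_mul]).imp_right fun h w h0 => ?_) w w'
    · intro a b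
      simpa [hσ] using h1 (σ a) (σ b)
    · have := h w h0
      show f w 0 = 20⁻¹ * f w 3
      linear_combination -(20⁻¹ : ℂ) * this

end Surface

lemma Proportional.not_linearIndependent {ι : Type*} {x y : ι → ℂ} (h : Proportional x y)
    (hx : x ≠ 0) (hy : y ≠ 0) : ¬ LinearIndependent ℂ ![x, y] := by
  obtain ⟨c, -, rfl⟩ := h.exists_smul hx hy
  intro hli
  have := LinearIndependent.pair_iff.1 hli 1 (-c) (by simp)
  exact one_ne_zero this.1

/-- For every degree `d ≥ 8` there is a Brody hyperbolic surface of
degree `d` in `ℙ³`: a nonzero homogeneous `F` of degree `d` such that every entire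
curve `g : ℂ → ℂ⁴ ∖ {0}` with `F ∘ g ≡ 0` has pairwise linearly dependent values. -/
theorem exists_hyperbolic_surface_of_degree_ge_eight
    (d : ℕ) (hd : 8 ≤ d) :
    ∃ F : MvPolynomial (Fin 4) ℂ, F ≠ 0 ∧ F.IsHomogeneous d ∧
      ∀ g : ℂ → (Fin 4 → ℂ), Differentiable ℂ g → (∀ w, g w ≠ 0) →
        (∀ w, eval (g w) F = 0) →
        ∀ w w' : ℂ, ¬ LinearIndependent ℂ ![g w, g w'] := by
  obtain ⟨m, rfl⟩ := Nat.exists_eq_add_of_le' hd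
  obtain ⟨ε, hε, H⟩ := exists_deformedCones_hyperbolic m
  exact ⟨deformedCones m ε, deformedCones_ne_zero m hε, isHomogeneous_deformedCones m ε,
    fun g hg hg0 hgF w w' => (H g hg hg0 hgF w w').not_linearIndependent (hg0 w) (hg0 w')⟩
end

section
/- Let f ∈ ℂ[w₁,w₂,w₃] be a squarefree homogeneous polynomial of degree n ≥ 1 with f(0,0,1) ≠ 0. Then there is a finite subset S of the projective line ℙ¹(ℂ) such that for every (x₁,x₂) ∈ ℂ²∖{(0,0)} with [x₁:x₂] ∉ S, the one-variable polynomial s ↦ f(x₁,x₂,s) (which has degree exactly n, since its leading coefficient is f(0,0,1)) has exactly n distinct complex roots. -/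
open MvPolynomial

theorem MulEquiv.squarefree_map {M N : Type*} [Monoid M] [Monoid N] (e : M ≃* N) {a : M}
    (ha : Squarefree a) : Squarefree (e a) := by
  intro x hx
  have h := map_dvd e.symm hx
  rw [map_mul, e.symm_apply_apply] at h
  simpa using (ha _ h).map e

/-- By Gauss's lemma, a primitive squarefree polynomial over a UFD stays squarefree over the
fraction field. -/
theorem Polynomial.IsPrimitive.squarefree_map_fraction_map {R K : Type*} [CommRing R] [IsDomain R]
    [UniqueFactorizationMonoid R] [Field K] [Algebra R K] [IsFractionRing R K]
    {p : Polynomial R} (hp : p.IsPrimitive) (hsf : Squarefree p) :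
    Squarefree (p.map (algebraMap R K)) := by
  have : NormalizedGCDMonoid R := Nonempty.some inferInstance
  intro h hh
  have hp0 : p.map (algebraMap R K) ≠ 0 :=
    (Polynomial.map_ne_zero_iff (IsFractionRing.injective R K)).2 hp.ne_zero
  have h0 : h ≠ 0 := by
    rintro rfl
    exact hp0 (by simpa using hh)
  refine Polynomial.isUnit_or_eq_zero_of_isUnit_integerNormalization_primPart (R := R) h0 ?_
  set q := IsLocalization.integerNormalization (nonZeroDivisors R) h
  apply hsf
  apply (q.isPrimitive_primPart.mul q.isPrimitive_primPart).dvd_of_fraction_map_dvd_fraction_map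
    (K := K)
  refine dvd_trans ?_ hh
  have hdvd : q.primPart.map (algebraMap R K) ∣ h := by
    obtain ⟨b, hb, hbq⟩ := IsLocalization.integerNormalization_spec (nonZeroDivisors R) h
    have hbu : IsUnit (Polynomial.C (algebraMap R K b)) :=
      Polynomial.isUnit_C.2 (IsLocalization.map_units K ⟨b, hb⟩)
    rw [← hbu.dvd_mul_left, ← Polynomial.algebraMap_apply, ← Algebra.smul_def, ← hbq]
    exact Polynomial.map_dvd _ (Polynomial.primPart_dvd q)
  rw [Polynomial.map_mul]
  exact mul_dvd_mul hdvd hdvd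

/-- A primitive squarefree polynomial over a UFD of characteristic zero specializes to a separable
polynomial away from the zero locus of a nonzero element of the base. -/
theorem Polynomial.IsPrimitive.exists_ne_zero_separable_map {R : Type*} [CommRing R] [IsDomain R]
    [UniqueFactorizationMonoid R] [CharZero R] {p : Polynomial R} (hp : p.IsPrimitive)
    (hsf : Squarefree p) :
    ∃ r : R, r ≠ 0 ∧ ∀ {k : Type*} [Field k] (φ : R →+* k), φ r ≠ 0 → (p.map φ).Separable := by
  let K := FractionRing R
  have : CharZero K := charZero_of_injective_algebraMap (IsFractionRing.injective R K)
  obtain ⟨a, b, hab⟩ := PerfectField.separable_iff_squarefree.2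
    (hp.squarefree_map_fraction_map (K := K) hsf)
  obtain ⟨c, hc, hca⟩ := IsLocalization.integerNormalization_spec (nonZeroDivisors R) a
  obtain ⟨d, hd, hdb⟩ := IsLocalization.integerNormalization_spec (nonZeroDivisors R) b
  set a' := IsLocalization.integerNormalization (nonZeroDivisors R) a
  set b' := IsLocalization.integerNormalization (nonZeroDivisors R) b
  have key : Polynomial.C d * a' * p + Polynomial.C c * b' * p.derivative
      = Polynomial.C (c * d) := by
    apply Polynomial.map_injective (algebraMap R K) (IsFractionRing.injective R K)
    rw [Algebra.smul_def, Polynomial.algebraMap_apply] at hca hdb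
    simp only [Polynomial.map_add, Polynomial.map_mul, Polynomial.map_C, hca, hdb, map_mul]
    rw [Polynomial.derivative_map] at hab
    linear_combination Polynomial.C (algebraMap R K c) * Polynomial.C (algebraMap R K d) * hab
  refine ⟨c * d, mul_ne_zero (nonZeroDivisors.ne_zero hc) (nonZeroDivisors.ne_zero hd),
    fun φ hφ => ?_⟩
  have h := congrArg (Polynomial.map φ) key
  simp only [Polynomial.map_add, Polynomial.map_mul, Polynomial.map_C] at h
  refine ⟨Polynomial.C (φ (c * d))⁻¹ * (Polynomial.C (φ d) * a'.map φ),
    Polynomial.C (φ (c * d))⁻¹ * (Polynomial.C (φ c) * b'.map φ), ?_⟩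
  have hinv : Polynomial.C (φ (c * d))⁻¹ * Polynomial.C (φ (c * d)) = 1 := by
    rw [← Polynomial.C_mul, inv_mul_cancel₀ hφ, Polynomial.C_1]
  rw [Polynomial.derivative_map]
  linear_combination Polynomial.C (φ (c * d))⁻¹ * h + hinv

namespace MvPolynomial

theorem IsHomogeneous.eval_smul {σ R : Type*} [CommSemiring R] {p : MvPolynomial σ R} {n : ℕ}
    (hp : p.IsHomogeneous n) (c : R) (x : σ → R) : eval (c • x) p = c ^ n * eval x p := by
  rw [eval_eq, eval_eq, Finset.mul_sum]
  refine Finset.sum_congr rfl fun d hd => ?_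
  rw [hp.degree_eq_sum_deg_support hd, ← Finset.prod_pow_eq_pow_sum]
  simp only [Pi.smul_apply, smul_eq_mul, mul_pow, Finset.prod_mul_distrib]
  ring

theorem IsHomogeneous.natDegree_finSuccEquiv_le {R : Type*} [CommSemiring R] {m n : ℕ}
    {p : MvPolynomial (Fin (m + 1)) R} (hp : p.IsHomogeneous n) :
    (finSuccEquiv R m p).natDegree ≤ n := by
  rw [natDegree_finSuccEquiv]
  exact (degreeOf_le_totalDegree p 0).trans hp.totalDegree_le

theorem IsHomogeneous.coeff_finSuccEquiv {R : Type*} [CommSemiring R] {m n : ℕ}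
    {p : MvPolynomial (Fin (m + 1)) R} (hp : p.IsHomogeneous n) :
    (finSuccEquiv R m p).coeff n = C (eval (Fin.cons 1 0) p) := by
  have hconst : (finSuccEquiv R m p).coeff n
      = C (constantCoeff ((finSuccEquiv R m p).coeff n)) := by
    have h0 := hp.finSuccEquiv_coeff_isHomogeneous n 0 (add_zero n)
    exact totalDegree_eq_zero_iff_eq_C.1 ((totalDegree_zero_iff_isHomogeneous _).2 h0)
  rw [hconst, eval_eq_eval_mv_eval',
    Polynomial.eval_eq_sum_range' (Nat.lt_succ_of_le
      (Polynomial.natDegree_map_le.trans hp.natDegree_finSuccEquiv_le)),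
    Finset.sum_range_succ, Finset.sum_eq_zero]
  · simp
  · intro i hi
    rw [Finset.mem_range] at hi
    have hi' := (hp.finSuccEquiv_coeff_isHomogeneous i (n - i) (by omega)).coeff_eq_zero
      (d := 0) (by simp; omega)
    simpa [constantCoeff_eq] using hi'

/-- A nonzero bivariate polynomial over an infinite domain is nonzero at all but finitely many
points of some line `x₁ = a` with `a ≠ 0`, the points being parametrized by the slope `t`. -/
theorem exists_finite_setOf_eval_eq_zero {k : Type*} [Field k] [Infinite k]
    {r : MvPolynomial (Fin 2) k} (hr : r ≠ 0) :
    ∃ a : k, a ≠ 0 ∧ {t : k | eval ![a, a * t] r = 0}.Finite := by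
  obtain ⟨y, hy⟩ : ∃ y, eval y (X 0 * r) ≠ 0 := by
    by_contra! h
    exact mul_ne_zero (X_ne_zero 0) hr (funext fun x => by simpa using h x)
  rw [map_mul, eval_X] at hy
  have hy0 := left_ne_zero_of_mul hy
  let g : Polynomial k := aeval ![Polynomial.C (y 0), Polynomial.C (y 0) * Polynomial.X] r
  have hg : ∀ t, g.eval t = eval ![y 0, y 0 * t] r := by
    intro t
    have : (Polynomial.aeval t).comp
        (aeval ![Polynomial.C (y 0), Polynomial.C (y 0) * Polynomial.X])
        = aeval (R := k) ![y 0, y 0 * t] := by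
      ext i
      fin_cases i <;> simp
    simpa [g, Polynomial.coe_aeval_eq_eval, coe_aeval_eq_eval] using DFunLike.congr_fun this r
  have hg0 : g ≠ 0 := by
    intro h
    have h1 := hg (y 1 / y 0)
    rw [h, Polynomial.eval_zero, mul_div_cancel₀ _ hy0] at h1
    refine right_ne_zero_of_mul hy ?_
    rw [h1]
    congr 2
    ext i
    fin_cases i <;> rfl
  refine ⟨y 0, hy0, ?_⟩
  convert Polynomial.finite_setOfPred_isRoot hg0 using 3 with t
  rw [Polynomial.IsRoot, hg]

end MvPolynomial

/-- For a squarefree homogeneous `f` of degree `n ≥ 1` with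
`f(0,0,1) ≠ 0`, a general fiber of the projection of the curve `{f = 0}` from
`(0:0:1)` has exactly `n` points: outside a finite set `S ⊂ ℙ¹`, the polynomial
`s ↦ f(x₁,x₂,s)` has exactly `n` distinct roots. -/
theorem general_fiber_has_n_points
    (n : ℕ) (hn : 1 ≤ n)
    (f : MvPolynomial (Fin 3) ℂ) (hsf : Squarefree f) (hfhom : f.IsHomogeneous n)
    (hfv : eval ![0, 0, 1] f ≠ 0) :
    ∃ S : Set (Projectivization ℂ (Fin 2 → ℂ)), S.Finite ∧
      ∀ x₁ x₂ : ℂ, (x₁, x₂) ≠ (0, 0) →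
        ∀ h : ![x₁, x₂] ≠ (0 : Fin 2 → ℂ),
          Projectivization.mk ℂ ![x₁, x₂] h ∉ S →
          {s : ℂ | eval ![x₁, x₂, s] f = 0}.ncard = n := by
  let e := renameEquiv ℂ (finRotate 3)
  let F := finSuccEquiv ℂ 2 (e f)
  have hefhom : (e f).IsHomogeneous n := hfhom.rename_isHomogeneous
  have heval : ∀ (y : Fin 2 → ℂ) (s : ℂ), (F.map (eval y)).eval s = eval ![y 0, y 1, s] f := by
    intro y s
    rw [← eval_eq_eval_mv_eval', renameEquiv_apply, eval_rename]
    congr 2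
    ext i
    fin_cases i <;> rfl
  have hcoeff : F.coeff n = C (eval ![0, 0, 1] f) := by
    rw [hefhom.coeff_finSuccEquiv, eval_eq_eval_mv_eval', heval]
    rfl
  have hFsf : Squarefree F :=
    MulEquiv.squarefree_map (finSuccEquiv ℂ 2).toMulEquiv (MulEquiv.squarefree_map e.toMulEquiv hsf)
  have hFprim : F.IsPrimitive := by
    intro r hr
    refine isUnit_of_dvd_unit (Polynomial.C_dvd_iff_dvd_coeff r F |>.1 hr n) ?_
    rw [hcoeff]
    exact (IsUnit.mk0 _ hfv).map C
  obtain ⟨r, hr, hsep⟩ := hFprim.exists_ne_zero_separable_map hFsf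
  have hcard : ∀ y : Fin 2 → ℂ, eval y r ≠ 0 → {s : ℂ | eval ![y 0, y 1, s] f = 0}.ncard = n := by
    intro y hy
    have hdeg : (F.map (eval y)).natDegree = n := by
      refine le_antisymm (Polynomial.natDegree_map_le.trans hefhom.natDegree_finSuccEquiv_le) ?_
      apply Polynomial.le_natDegree_of_ne_zero
      rwa [Polynomial.coeff_map, hcoeff, eval_C]
    have hs := hsep (eval y) hy
    have hroots := Polynomial.card_rootSet_eq_natDegree (K := ℂ) hs (IsAlgClosed.splits _)
    rw [hdeg, ← Nat.card_eq_fintype_card, Nat.card_coe_set_eq] at hroots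
    rw [← hroots]
    congr 1
    ext s
    rw [Polynomial.mem_rootSet_of_ne hs.ne_zero, Polynomial.coe_aeval_eq_eval, heval]
    rfl
  obtain ⟨a, ha, hfin⟩ := exists_finite_setOf_eval_eq_zero hr
  have hne : ∀ t : ℂ, ![1, t] ≠ (0 : Fin 2 → ℂ) := fun t h => one_ne_zero (congrFun h 0)
  have hne' : ![0, 1] ≠ (0 : Fin 2 → ℂ) := fun h => one_ne_zero (congrFun h 1)
  refine ⟨insert (Projectivization.mk ℂ ![0, 1] hne')
    ((fun t => Projectivization.mk ℂ ![1, t] (hne t)) '' {t | eval ![a, a * t] r = 0}),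
    (hfin.image _).insert _, fun x₁ x₂ hx h hS => ?_⟩
  rw [Set.mem_insert_iff, not_or] at hS
  have hx₁ : x₁ ≠ 0 := by
    rintro rfl
    refine hS.1 ((Projectivization.mk_eq_mk_iff' ℂ _ _ h hne').2 ⟨x₂, ?_⟩)
    ext i
    fin_cases i <;> simp
  have hr0 : eval ![a, a * (x₂ / x₁)] r ≠ 0 := by
    refine fun h0 => hS.2 ⟨x₂ / x₁, h0, ?_⟩
    refine (Projectivization.mk_eq_mk_iff' ℂ _ _ (hne _) h).2 ⟨x₁⁻¹, ?_⟩
    ext i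
    fin_cases i <;> simp [hx₁, div_eq_inv_mul]
  rw [← hcard _ hr0]
  have hc : a / x₁ ≠ 0 := div_ne_zero ha hx₁
  refine Set.ncard_congr' ((Equiv.mulLeft₀ (a / x₁) hc).subtypeEquiv fun s => ?_)
  have hvec : ![a, a * (x₂ / x₁), a / x₁ * s] = (a / x₁) • ![x₁, x₂, s] := by
    ext i
    fin_cases i <;> simp <;> field_simp
  change eval ![x₁, x₂, s] f = 0 ↔ eval ![a, a * (x₂ / x₁), a / x₁ * s] f = 0
  rw [hvec, hfhom.eval_smul, mul_eq_zero, or_iff_right (pow_ne_zero _ hc)]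
end

section
/- Let U ⊆ ℂ be a nonempty open connected set, let f₁, f₂, f_∞ ∈ ℂ[z₁,z₂,z₃,z₄] be polynomials (viewed as polynomial functions ℂ⁴ → ℂ), let (t_k) be a sequence of nonzero complex numbers, and let g_k, g : U → ℂ⁴ be holomorphic maps such that: (i) g_k → g locally uniformly on U; (ii) for every k and every w ∈ U, f₁(g_k(w))·f₂(g_k(w)) + t_k·f_∞(g_k(w)) = 0; (iii) f_∞(g(w)) ≠ 0 for every w ∈ U. If f₂(g(w₀)) = 0 for some w₀ ∈ U, then f₂(g(w)) = 0 for all w ∈ U. -/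
open MvPolynomial

open Filter Topology Metric Set

/-- Locally uniform convergence to a continuous limit is compatible with the compact-open
topology. -/
theorem TendstoLocallyUniformlyOn.eventually_mapsTo_of_isCompact {ι α β : Type*}
    [TopologicalSpace α] [UniformSpace β] {F : ι → α → β} {f : α → β} {p : Filter ι}
    {U K : Set α} {V : Set β} (hF : TendstoLocallyUniformlyOn F f p U) (hU : IsOpen U)
    (hf : ContinuousOn f U) (hK : IsCompact K) (hKU : K ⊆ U) (hV : IsOpen V)
    (hfKV : MapsTo f K V) : ∀ᶠ n in p, MapsTo (F n) K V := by
  have hmem : {q : ι × α | F q.1 q.2 ∈ V} ∈ p ×ˢ 𝓝ˢ K := by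
    refine hK.mem_prod_nhdsSet_of_forall fun y hy ↦ ?_
    have hfy : Tendsto (fun q : ι × α ↦ f q.2) (p ×ˢ 𝓝 y) (𝓝 (f y)) :=
      (hf.continuousAt (hU.mem_nhds (hKU hy))).tendsto.comp tendsto_snd
    exact (hfy.congr_uniformity (hU.tendstoLocallyUniformlyOn_iff_forall_tendsto.1 hF y (hKU hy)))
      (hV.mem_nhds (hfKV hy))
  obtain ⟨s, hs, t, ht, hst⟩ := mem_prod_iff.1 hmem
  filter_upwards [hs] with n hn x hx
  exact hst (mk_mem_prod hn (subset_of_mem_nhdsSet ht hx))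

/-- **Minimum modulus principle** on a closed disc, at its center. -/
theorem Complex.le_norm_center_of_forall_mem_sphere_le {h : ℂ → ℂ} {c : ℂ} {r δ : ℝ}
    (hr : 0 < r) (hδ : 0 < δ) (hh : DifferentiableOn ℂ h (closedBall c r))
    (hne : ∀ z ∈ closedBall c r, h z ≠ 0) (hle : ∀ z ∈ sphere c r, δ ≤ ‖h z‖) :
    δ ≤ ‖h c‖ := by
  have hd : DiffContOnCl ℂ (fun z ↦ (h z)⁻¹) (ball c r) :=
    (hh.fun_inv hne).diffContOnCl_ball subset_rfl
  have hinv : ‖(h c)⁻¹‖ ≤ δ⁻¹ := by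
    refine norm_le_of_forall_mem_frontier_norm_le isBounded_ball hd (fun z hz ↦ ?_)
      (subset_closure (mem_ball_self hr))
    rw [frontier_ball c hr.ne'] at hz
    rw [norm_inv]
    exact inv_anti₀ hδ (hle z hz)
  rw [norm_inv] at hinv
  exact (inv_le_inv₀ (norm_pos_iff.2 (hne c (mem_closedBall_self hr.le))) hδ).1 hinv

theorem DifferentiableOn.eval_mvPolynomial {σ : Type*} [Fintype σ] {U : Set ℂ} {g : ℂ → σ → ℂ}
    (hg : DifferentiableOn ℂ g U) (p : MvPolynomial σ ℂ) :
    DifferentiableOn ℂ (fun z ↦ eval (g z) p) U :=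
  (AnalyticOnNhd.eval_mvPolynomial (𝕜 := ℂ) p).differentiableOn.comp hg (mapsTo_univ _ _)

/-- **Hurwitz step of the deformation method.** If holomorphic maps
`g_k : U → ℂ⁴` satisfying `f₁(g_k) f₂(g_k) + t_k f_∞(g_k) = 0` (with `t_k ≠ 0`)
converge locally uniformly on a domain `U` to a holomorphic map `g` with
`f_∞(g) ≠ 0` everywhere on `U`, and `f₂(g)` vanishes at one point of `U`, then
`f₂(g) ≡ 0` on `U`. -/
theorem hurwitz_step
    (U : Set ℂ) (hUne : U.Nonempty) (hUo : IsOpen U) (hUc : IsConnected U)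
    (f₁ f₂ finf : MvPolynomial (Fin 4) ℂ)
    (t : ℕ → ℂ) (ht : ∀ k, t k ≠ 0)
    (gk : ℕ → ℂ → (Fin 4 → ℂ)) (g : ℂ → (Fin 4 → ℂ))
    (hgk : ∀ k, DifferentiableOn ℂ (gk k) U)
    (hg : DifferentiableOn ℂ g U)
    (hconv : TendstoLocallyUniformlyOn gk g Filter.atTop U)
    (heq : ∀ k, ∀ w ∈ U,
      eval (gk k w) f₁ * eval (gk k w) f₂ + t k * eval (gk k w) finf = 0)
    (hfinf : ∀ w ∈ U, eval (g w) finf ≠ 0)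
    (w₀ : ℂ) (hw₀ : w₀ ∈ U) (h₀ : eval (g w₀) f₂ = 0) :
    ∀ w ∈ U, eval (g w) f₂ = 0 := by
  have hh : DifferentiableOn ℂ (fun z ↦ eval (g z) f₂) U := hg.eval_mvPolynomial f₂
  have hc₂ : Continuous fun x : Fin 4 → ℂ ↦ eval x f₂ := f₂.continuous_eval
  have hcinf : Continuous fun x : Fin 4 → ℂ ↦ eval x finf := finf.continuous_eval
  by_contra hnot
  have hisol : ∀ᶠ z in 𝓝[≠] w₀, eval (g z) f₂ ≠ 0 := by
    by_contra hfreq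
    exact hnot ((hh.analyticOnNhd hUo).eqOn_zero_of_preconnected_of_frequently_eq_zero
      hUc.isPreconnected hw₀ hfreq)
  rw [eventually_nhdsWithin_iff] at hisol
  obtain ⟨r, hr, hball⟩ :=
    nhds_basis_closedBall.eventually_iff.1 (hisol.and (hUo.eventually_mem hw₀))
  have hKU : closedBall w₀ r ⊆ U := fun z hz ↦ (hball hz).2
  have hSK : sphere w₀ r ⊆ closedBall w₀ r := sphere_subset_closedBall
  have hpos : ∀ z ∈ sphere w₀ r, 0 < ‖eval (g z) f₂‖ := fun z hz ↦
    norm_pos_iff.2 ((hball (hSK hz)).1 (ne_of_mem_sphere hz hr.ne'))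
  obtain ⟨δ, hδ, hδS⟩ := (isCompact_sphere w₀ r).exists_forall_le'
    (hh.continuousOn.norm.mono (hSK.trans hKU)) hpos
  have hev {K : Set ℂ} (hK : IsCompact K) (hKU : K ⊆ U) {V : Set (Fin 4 → ℂ)}
      (hV : IsOpen V) (hKV : MapsTo g K V) : ∀ᶠ k in atTop, MapsTo (gk k) K V :=
    hconv.eventually_mapsTo_of_isCompact hUo hg.continuousOn hK hKU hV hKV
  have h1 := hev (isCompact_closedBall w₀ r) hKU (isOpen_ne_fun hcinf continuous_const)
    fun z hz ↦ hfinf z (hKU hz)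
  have h2 := hev (isCompact_sphere w₀ r) (hSK.trans hKU)
    (isOpen_lt (continuous_const (y := δ / 2)) hc₂.norm)
    fun z hz ↦ (half_lt_self hδ).trans_le (hδS z hz)
  have h3 := hev (isCompact_singleton (x := w₀)) (singleton_subset_iff.2 hw₀)
    (isOpen_lt hc₂.norm (continuous_const (y := δ / 2)))
    (by rintro z rfl; simpa [h₀] using hδ)
  obtain ⟨k, hk1, hk2, hk3⟩ := (h1.and (h2.and h3)).exists
  refine (hk3 rfl).not_ge (Complex.le_norm_center_of_forall_mem_sphere_le
    (h := fun z ↦ eval (gk k z) f₂) hr (half_pos hδ)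
    (((hgk k).eval_mvPolynomial f₂).mono hKU) (fun z hz hzero ↦ ?_) fun z hz ↦ (hk2 hz).le)
  have hz_eq := heq k z (hKU hz)
  rw [hzero, mul_zero, zero_add] at hz_eq
  exact mul_ne_zero (ht k) (hk1 hz) hz_eq
end
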